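/- Let d = 3, let p > 5 be a real number, and let m ≥ 40 be an integer. Then there exists S > 0 and a smooth nowhere-vanishing function u : Γ₃ → ℝ^m \ {0} which satisfies u(e^S t, e^S x) = e^{−(2/(p−1))S} u(t,x) on Γ₃, satisfies ⟨u, □u⟩ > 0 throughout Γ₃, and satisfies ∂_α⟨u, □u⟩ = (p+1)⟨∂_α u, □u⟩ on Γ₃ for each coordinate derivative ∂_α ∈ {∂_t, ∂_{x_1}, ∂_{x_2}, ∂_{x_3}}. Furthermore, the map θ : Γ₃ → S^{m−1} defined by θ(t,x) := u(t,x)/‖u(t,x)‖ is injective up to the discrete scaling, meaning that θ(t,x) = θ(t',x') for (t,x),(t',x') ∈ Γ₃ implies (t',x') = (e^{nS}t, e^{nS}x) for some integer n, and θ is immersed in the sense that the four vectors ∂_t θ(t,x), ∂_{x_1}θ(t,x), ∂_{x_2}θ(t,x), ∂_{x_3}θ(t,x) are linearly independent in ℝ^m for every (t,x) ∈ Γ₃. -/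

import Mathlib

open Real MeasureTheory
open scoped RealInnerProductSpace

noncomputable section

/-- Spacetime `ℝ^{1+d}` realised as `Fin (d+1) → ℝ`; coordinate `0` is the time `t`,
coordinates `i.succ` are the spatial coordinates `x_i`. -/
abbrev Sp (d : ℕ) := Fin (d + 1) → ℝ

/-- The Euclidean target space `ℝ^m`. -/
abbrev Em (m : ℕ) := EuclideanSpace ℝ (Fin m)

/-- The coordinate partial derivative `∂_α`. -/
def pd {d : ℕ} {E : Type*} [NormedAddCommGroup E] [NormedSpace ℝ E]
    (α : Fin (d + 1)) (f : Sp d → E) : Sp d → E :=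
  fun x => fderiv ℝ f x (Pi.single α 1)

/-- The d'Alembertian `□ = -∂_t² + ∑_i ∂_{x_i}²`. -/
def dAlembert {d : ℕ} {E : Type*} [NormedAddCommGroup E] [NormedSpace ℝ E]
    (f : Sp d → E) : Sp d → E :=
  fun x => -(pd 0 (pd 0 f) x) + ∑ i : Fin d, pd i.succ (pd i.succ f) x

/-- The (truncated, solid) light cone `Γ_d = {(t,x) : t > 0, |x| ≤ t}`,
with `|x|` the Euclidean norm. -/
def Cone (d : ℕ) : Set (Sp d) :=
  {y | 0 < y 0 ∧ ∑ i : Fin d, (y i.succ) ^ 2 ≤ (y 0) ^ 2}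

open scoped ContDiff

section Calculus

variable {d : ℕ} {E : Type*} [NormedAddCommGroup E] [NormedSpace ℝ E]

/-- `f` is differentiable at `y` and its coordinate derivative `∂_α f` there is `f'`. -/
def HasPd (α : Fin (d + 1)) (f : Sp d → E) (f' : E) (y : Sp d) : Prop :=
  DifferentiableAt ℝ f y ∧ fderiv ℝ f y (Pi.single α 1) = f'

namespace HasPd

variable {α : Fin (d + 1)} {y : Sp d}

lemma pd_eq {f : Sp d → E} {f' : E} (h : HasPd α f f' y) : pd α f y = f' := h.2

lemma of_differentiableAt {f : Sp d → E} (h : DifferentiableAt ℝ f y) :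
    HasPd α f (pd α f y) y := ⟨h, rfl⟩

lemma const (c : E) : HasPd α (fun _ => c) 0 y := by
  refine ⟨differentiableAt_const _, ?_⟩
  simp

lemma coord (β : Fin (d + 1)) :
    HasPd α (fun z : Sp d => z β) (if β = α then (1 : ℝ) else 0) y := by
  have h : HasFDerivAt (fun z : Sp d => z β)
      (ContinuousLinearMap.proj β : (Fin (d + 1) → ℝ) →L[ℝ] ℝ) y := hasFDerivAt_apply β y
  refine ⟨h.differentiableAt, ?_⟩
  rw [h.fderiv]
  simp [Pi.single_apply]

lemma add {f g : Sp d → E} {f' g' : E} (hf : HasPd α f f' y) (hg : HasPd α g g' y) :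
    HasPd α (fun z => f z + g z) (f' + g') y := by
  refine ⟨hf.1.add hg.1, ?_⟩
  rw [fderiv_fun_add hf.1 hg.1, add_apply, hf.2, hg.2]

lemma neg {f : Sp d → E} {f' : E} (hf : HasPd α f f' y) :
    HasPd α (fun z => -f z) (-f') y := by
  refine ⟨hf.1.neg, ?_⟩
  rw [fderiv_fun_neg, neg_apply, hf.2]

lemma sum {ι : Type*} {s : Finset ι} {f : ι → Sp d → E} {f' : ι → E}
    (h : ∀ i ∈ s, HasPd α (f i) (f' i) y) :
    HasPd α (fun z => ∑ i ∈ s, f i z) (∑ i ∈ s, f' i) y := by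
  refine ⟨DifferentiableAt.fun_sum fun i hi => (h i hi).1, ?_⟩
  rw [fderiv_fun_sum fun i hi => (h i hi).1, sum_apply]
  exact Finset.sum_congr rfl fun i hi => (h i hi).2

lemma mul {f g : Sp d → ℝ} {f' g' : ℝ} (hf : HasPd α f f' y) (hg : HasPd α g g' y) :
    HasPd α (fun z => f z * g z) (f' * g y + f y * g') y := by
  refine ⟨hf.1.mul hg.1, ?_⟩
  rw [fderiv_fun_mul hf.1 hg.1]
  simp only [add_apply, smul_apply, hf.2, hg.2, smul_eq_mul]
  ring

lemma const_mul {f : Sp d → ℝ} {f' : ℝ} (c : ℝ) (hf : HasPd α f f' y) :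
    HasPd α (fun z => c * f z) (c * f') y := by
  simpa using (const (y := y) (α := α) c).mul hf

lemma smul_const {f : Sp d → ℝ} {f' : ℝ} (hf : HasPd α f f' y) (c : E) :
    HasPd α (fun z => f z • c) (f' • c) y := by
  refine ⟨hf.1.smul_const c, ?_⟩
  have h2 : fderiv ℝ (fun z => f z • c) y = (fderiv ℝ f y).smulRight c :=
    (hf.1.hasFDerivAt.smul_const c).fderiv
  rw [h2, ContinuousLinearMap.smulRight_apply, hf.2]

lemma comp {f : Sp d → ℝ} {f' : ℝ} {φ : ℝ → ℝ} {φ' : ℝ} (hφ : HasDerivAt φ φ' (f y))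
    (hf : HasPd α f f' y) : HasPd α (fun z => φ (f z)) (φ' * f') y := by
  have h := hφ.comp_hasFDerivAt y hf.1.hasFDerivAt
  refine ⟨h.differentiableAt, ?_⟩
  have h2 : fderiv ℝ (fun z => φ (f z)) y = φ' • fderiv ℝ f y := h.fderiv
  rw [h2, smul_apply, hf.2, smul_eq_mul]

lemma inner {F : Type*} [NormedAddCommGroup F] [InnerProductSpace ℝ F] {f g : Sp d → F}
    {f' g' : F} (hf : HasPd α f f' y) (hg : HasPd α g g' y) :
    HasPd α (fun z => ⟪f z, g z⟫) (⟪f y, g'⟫ + ⟪f', g y⟫) y := by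
  refine ⟨hf.1.inner ℝ hg.1, ?_⟩
  rw [fderiv_inner_apply ℝ hf.1 hg.1, hf.2, hg.2]

lemma congr_of_eqOn {f g : Sp d → E} {f' : E} {Ω : Set (Sp d)} (hΩ : IsOpen Ω) (hy : y ∈ Ω)
    (hfg : Set.EqOn g f Ω) (hf : HasPd α f f' y) : HasPd α g f' y := by
  have h : g =ᶠ[nhds y] f := hfg.eventuallyEq_of_mem (hΩ.mem_nhds hy)
  exact ⟨h.symm.differentiableAt_iff.1 hf.1, by rw [h.fderiv_eq, hf.2]⟩

end HasPd

lemma contDiffOn_pd {u : Sp d → E} {Ω : Set (Sp d)} (hΩ : IsOpen Ω) (hu : ContDiffOn ℝ ∞ u Ω)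
    (α : Fin (d + 1)) : ContDiffOn ℝ ∞ (pd α u) Ω :=
  (hu.fderiv_of_isOpen hΩ (by simp)).clm_apply contDiffOn_const

lemma hasPd_of_contDiffOn {u : Sp d → E} {Ω : Set (Sp d)} (hΩ : IsOpen Ω)
    (hu : ContDiffOn ℝ ∞ u Ω) (α : Fin (d + 1)) {y : Sp d} (hy : y ∈ Ω) :
    HasPd α u (pd α u y) y :=
  HasPd.of_differentiableAt ((hu.differentiableOn (by simp)).differentiableAt (hΩ.mem_nhds hy))

lemma pd_comm {u : Sp d → E} {Ω : Set (Sp d)} (hΩ : IsOpen Ω) (hu : ContDiffOn ℝ ∞ u Ω)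
    (α β : Fin (d + 1)) {y : Sp d} (hy : y ∈ Ω) : pd α (pd β u) y = pd β (pd α u) y := by
  have hat : ContDiffAt ℝ ∞ u y := hu.contDiffAt (hΩ.mem_nhds hy)
  have hsymm : IsSymmSndFDerivAt ℝ u y := hat.isSymmSndFDerivAt (by simpa using WithTop.coe_le_coe.2 (le_top : (2 : ℕ∞) ≤ ⊤))
  have hd : DifferentiableAt ℝ (fderiv ℝ u) y :=
    ((hu.fderiv_of_isOpen hΩ (m := ∞) (by simp)).differentiableOn (by simp)).differentiableAt
      (hΩ.mem_nhds hy)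
  have key : ∀ γ δ : Fin (d + 1), pd γ (pd δ u) y
      = fderiv ℝ (fderiv ℝ u) y (Pi.single γ 1) (Pi.single δ 1) := by
    intro γ δ
    have := fderiv_clm_apply hd (differentiableAt_const (Pi.single δ (1 : ℝ) : Sp d))
    unfold pd
    rw [this]
    simp
  rw [key, key]
  exact hsymm _ _

end Calculus

section StressEnergy

variable {d : ℕ} {F : Type*} [NormedAddCommGroup F] [InnerProductSpace ℝ F]
  {u : Sp d → F} {Ω : Set (Sp d)}

/-- `⟨u, □u⟩` in terms of the mass density `|u|²` and the Gram matrix `⟨∂_α u, ∂_β u⟩`. -/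
lemma inner_dAlembert (hΩ : IsOpen Ω) (hu : ContDiffOn ℝ ∞ u Ω) {y : Sp d} (hy : y ∈ Ω) :
    ⟪u y, dAlembert u y⟫ = dAlembert (fun z => ⟪u z, u z⟫) y / 2
      - (-⟪pd 0 u y, pd 0 u y⟫ + ∑ i : Fin d, ⟪pd i.succ u y, pd i.succ u y⟫) := by
  have h2 : ∀ α : Fin (d + 1), pd α (pd α fun z => ⟪u z, u z⟫) y
      = 2 * ⟪u y, pd α (pd α u) y⟫ + 2 * ⟪pd α u y, pd α u y⟫ := by
    intro α
    have h1 : Set.EqOn (pd α fun z => ⟪u z, u z⟫) (fun z => 2 * ⟪u z, pd α u z⟫) Ω := by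
      intro z hz
      have hp := hasPd_of_contDiffOn hΩ hu α hz
      rw [(hp.inner hp).pd_eq, real_inner_comm (u z)]
      ring
    have hp := hasPd_of_contDiffOn hΩ hu α hy
    have hpp := hasPd_of_contDiffOn hΩ (contDiffOn_pd hΩ hu α) α hy
    rw [(((hp.inner hpp).const_mul 2).congr_of_eqOn hΩ hy h1).pd_eq]
    ring
  simp only [dAlembert, h2, inner_add_right, inner_neg_right, inner_sum, Finset.sum_add_distrib,
    ← Finset.mul_sum]
  ring

/-- `⟨∂_α u, □u⟩` is the divergence of the trace-reversed Gram matrix. -/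
lemma inner_pd_dAlembert (hΩ : IsOpen Ω) (hu : ContDiffOn ℝ ∞ u Ω) (α : Fin (d + 1))
    {y : Sp d} (hy : y ∈ Ω) :
    ⟪pd α u y, dAlembert u y⟫ =
      -pd 0 (fun z => ⟪pd α u z, pd 0 u z⟫) y
        + ∑ i : Fin d, pd i.succ (fun z => ⟪pd α u z, pd i.succ u z⟫) y
        - (-pd α (fun z => ⟪pd 0 u z, pd 0 u z⟫) y
          + ∑ i : Fin d, pd α (fun z => ⟪pd i.succ u z, pd i.succ u z⟫) y) / 2 := by
  have hp : ∀ β γ : Fin (d + 1), HasPd γ (pd β u) (pd γ (pd β u) y) y := fun β γ =>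
    hasPd_of_contDiffOn hΩ (contDiffOn_pd hΩ hu β) γ hy
  have h : ∀ β : Fin (d + 1), pd β (fun z => ⟪pd α u z, pd β u z⟫) y
      = ⟪pd α u y, pd β (pd β u) y⟫ + pd α (fun z => ⟪pd β u z, pd β u z⟫) y / 2 := by
    intro β
    rw [((hp α β).inner (hp β β)).pd_eq, ((hp β α).inner (hp β α)).pd_eq, pd_comm hΩ hu α β hy,
      real_inner_comm (pd β u y)]
    ring
  simp only [h, dAlembert, inner_add_right, inner_neg_right, inner_sum, Finset.sum_add_distrib,
    ← Finset.sum_div]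
  ring

end StressEnergy

section Profile

/-- The quartic bound controlling `(1 - s) * (1 - w ^ γ) / γ`. -/
lemma quartic_bound {x : ℝ} (h0 : 0 ≤ x) (h1 : x ≤ 1) :
    4 * x ^ 3 * (1 - x) ≤ 27 / 100 + 5 / 6 * (x ^ 4 * (1 - x ^ 4)) := by
  have hp : ∀ k : ℕ, x ^ (k + 2) ≤ x ^ 2 := fun k => pow_le_pow_of_le_one h0 h1 (by omega)
  have hq : 0 ≤ 1310 / 2187 + 434 / 243 * x + 1949 / 486 * x ^ 2 - 80 / 81 * x ^ 3
      - 10 / 9 * x ^ 4 - 10 / 9 * x ^ 5 - 5 / 6 * x ^ 6 := by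
    have hx : x ^ 2 ≤ x := by nlinarith
    have h3 : x ^ 3 ≤ x ^ 2 := hp 1
    have h4 : x ^ 4 ≤ x ^ 2 := hp 2
    have h5 : x ^ 5 ≤ x ^ 2 := hp 3
    have h6 : x ^ 6 ≤ x ^ 2 := hp 4
    linarith [sq_nonneg x]
  have := mul_nonneg (sq_nonneg (x - 2 / 3)) hq
  linarith

lemma one_sub_rpow_le {w γ : ℝ} (hw : 0 < w) (hγ : 0 < γ) :
    w * ((1 - w ^ γ) / γ) ≤ 4 * (w ^ (1 / 4 : ℝ)) ^ 3 * (1 - w ^ (1 / 4 : ℝ)) := by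
  have hx : 0 < w ^ (1 / 4 : ℝ) := Real.rpow_pos_of_pos hw _
  have hx4 : (w ^ (1 / 4 : ℝ)) ^ 4 = w := by
    rw [← Real.rpow_natCast, ← Real.rpow_mul hw.le]
    norm_num
  have hlogx : Real.log w = 4 * Real.log (w ^ (1 / 4 : ℝ)) := by
    rw [Real.log_rpow hw]
    ring
  set x := w ^ (1 / 4 : ℝ)
  have h1 : (1 - w ^ γ) / γ ≤ -Real.log w := by
    rw [div_le_iff₀ hγ, Real.rpow_def_of_pos hw]
    linarith [Real.add_one_le_exp (Real.log w * γ)]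
  have h2 : -Real.log x ≤ 1 / x - 1 := by
    have := Real.log_le_sub_one_of_pos (one_div_pos.2 hx)
    rwa [Real.log_div one_ne_zero hx.ne', Real.log_one, zero_sub] at this
  have h3 : (1 - w ^ γ) / γ ≤ 4 * (1 / x - 1) := by linarith
  calc w * ((1 - w ^ γ) / γ) ≤ w * (4 * (1 / x - 1)) := by gcongr
    _ = 4 * x ^ 3 * (1 - x) := by
      rw [← hx4]
      field_simp

variable {a γ ν s w W Q : ℝ}

/-- Positivity of the rescaled potential `g`. -/
lemma profile_g_pos (ha : 0 < a) (ha2 : a < 1 / 2)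
    (hγ0 : 0 < γ) (hγ1 : γ < 1) (hν0 : 0 < ν) (hν : ν ≤ 1 / 200)
    (hs0 : 0 ≤ s) (hs1 : s ≤ 1) (hw : w = 1 - (1 - ν) * s) (hWQ : w * W = 1 - γ * Q)
    (hνW : ν * W ≤ 1 / 200) (hQ : (1 - ν) * s ≤ Q) :
    0 < (1 - s) * ((1 + γ / 2 + 1 / 100) * (1 - ν) * s * W - s * (2 + a) / 2 + 1 / 100
          + (1 + a) * (1 + γ / 2 + 1 / 100) * Q) - s
        + (γ / 100 / (1 + a) + (1 + γ / 2 + 1 / 100) * (γ * Q) - γ / 2 * s) := by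
  have e : (1 - s) * ((1 + γ / 2 + 1 / 100) * (1 - ν) * s * W - s * (2 + a) / 2 + 1 / 100
          + (1 + a) * (1 + γ / 2 + 1 / 100) * Q) - s
        + (γ / 100 / (1 + a) + (1 + γ / 2 + 1 / 100) * (γ * Q) - γ / 2 * s)
      = s * (1 / 100 - (1 + γ / 2 + 1 / 100) * (ν * W))
        + (1 - s) * ((1 + γ / 2 + 1 / 100) * (γ + 1 + a) * Q - s * (2 + a) / 2)
        + (1 - s) / 100 + γ / 100 / (1 + a) := by
    subst hw
    linear_combination (1 + γ / 2 + 1 / 100) * s * hWQ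
  have h1 : 0 ≤ s * (1 / 100 - (1 + γ / 2 + 1 / 100) * (ν * W)) := by
    refine mul_nonneg hs0 ?_
    nlinarith
  have hγa : γ + 1 + a ≥ 1 + a / 2 := by linarith
  have h2 : s * (2 + a) / 2 ≤ (1 + γ / 2 + 1 / 100) * (γ + 1 + a) * Q := by
    have h21 : 1 ≤ (1 + γ / 2 + 1 / 100) * (1 - ν) := by nlinarith
    have h22 : s ≤ (1 + γ / 2 + 1 / 100) * Q := by
      calc s ≤ (1 + γ / 2 + 1 / 100) * (1 - ν) * s := by nlinarith
        _ ≤ _ := by rw [mul_assoc]; gcongr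
    nlinarith
  have h3 : 0 ≤ (1 - s) * ((1 + γ / 2 + 1 / 100) * (γ + 1 + a) * Q - s * (2 + a) / 2) :=
    mul_nonneg (by linarith) (by linarith)
  rw [e]
  have : 0 < γ / 100 / (1 + a) := by positivity
  have : 0 ≤ (1 - s) / 100 := by linarith
  linarith

lemma profile_V_identity {l r : ℝ} (hγ : γ * (1 + 2 * a) = (1 + a) * (1 - 2 * a))
    (hd : r * (1 + 2 * a) = (1 - 2 * a) / 100) (hl : l = 1 + γ / 2 + 1 / 100)
    (hw : w = 1 - (1 - ν) * s) (hWQ : w * W = 1 - γ * Q) :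
    (1 + 2 * a) * ((2 + 2 * a) * ((1 - s) * (l * (1 - ν) * s * W
          - s * (2 + a) / 2 + 1 / 100 + (1 + a) * l * Q) - s)
        + (1 + 2 * a) * (r + l * (γ * Q) - γ / 2 * s))
      = 2 * (1 + a) * ((1 - 2 * a) * s / 4
          + 3 / 2 * ((3 + 3 * a - 2 * a ^ 2) / 2 + (1 + 2 * a) / 100) * ((1 - s) * Q)
          - l * Q * s * (1 - 2 * a) / 2
          - (1 + 2 * a) * (2 + a) / 2 * (s * (1 - s)) + (1 + 2 * a) / 100
          - (1 + 2 * a) * l * s * (ν * W))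
        + (1 + 2 * a) * (1 - 2 * a) / 100 := by
    have hK : (1 + 2 * a) * l = (3 + 3 * a - 2 * a ^ 2) / 2 + (1 + 2 * a) / 100 := by
      linear_combination (1 + 2 * a) * hl + hγ / 2
    have hF : (1 - s) * (l * (1 - ν) * s * W
          - s * (2 + a) / 2 + 1 / 100 + (1 + a) * l * Q) - s
        = s * (l - 1) - l * s * (γ * Q + ν * W)
          - s * (1 - s) * (2 + a) / 2 + (1 - s) / 100
          + (1 + a) * l * ((1 - s) * Q) := by
      subst hw
      linear_combination l * s * hWQ
    rw [hF]
    linear_combination (1 + 2 * a) * hd + (-(1 + 2 * a) * s / 2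
        + l * Q * ((1 + 2 * a) - 2 * (1 + a) * s)) * hγ
      + (2 * (1 + a) * s
        + (1 - s) * Q * (2 * (1 + a) ^ 2 + (1 + a) * (1 - 2 * a))) * hK

lemma profile_V_poly (ha : 0 < a) (ha2 : a < 1 / 2) :
    (1 - 2 * a) / 32 + 3 / 2 * ((3 + 3 * a - 2 * a ^ 2) / 2 + (1 + 2 * a) / 100)
          * (27 / 100) + (7 / 8 - 5 / 8 * a - 9 / 4 * a ^ 2) * (1 / 4)
          + 5 / 4 * ((1 + 2 * a) / 100 * (1 / 4))
          + 5 / 4 * (((3 + 3 * a - 2 * a ^ 2) / 2 + (1 + 2 * a) / 100) * (1 / 200))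
          + (1 + 2 * a) / 100 ≤ (3 / 2 - 1 / 10) / (1 + a) := by
  rw [le_div_iff₀ (by linarith)]
  nlinarith [mul_pos ha ha, mul_pos (mul_pos ha ha) ha]

lemma profile_V_estimate {l : ℝ} (ha : 0 < a) (ha2 : a < 1 / 2) (hν : ν ≤ 1 / 200)
    (hs0 : 0 ≤ s) (hQs : s ≤ l * Q)
    (hT : (1 - s) * Q ≤ 27 / 100 + 5 / 6 * (s * (1 - s) + ν)) :
    (1 - 2 * a) * s / 4 + 3 / 2 * ((3 + 3 * a - 2 * a ^ 2) / 2 + (1 + 2 * a) / 100)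
        * ((1 - s) * Q)
      - l * Q * s * (1 - 2 * a) / 2
      - (1 + 2 * a) * (2 + a) / 2 * (s * (1 - s)) + (1 + 2 * a) / 100
      ≤ (3 / 2 - 1 / 10) / (1 + a) := by
  have hT2 : 3 / 2 * ((3 + 3 * a - 2 * a ^ 2) / 2 + (1 + 2 * a) / 100) * ((1 - s) * Q)
      ≤ 3 / 2 * ((3 + 3 * a - 2 * a ^ 2) / 2 + (1 + 2 * a) / 100)
        * (27 / 100 + 5 / 6 * (s * (1 - s) + ν)) := by
    have : 0 ≤ 3 / 2 * ((3 + 3 * a - 2 * a ^ 2) / 2 + (1 + 2 * a) / 100) := by nlinarith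
    gcongr
  have hsQ : s * s * (1 - 2 * a) / 2 ≤ l * Q * s * (1 - 2 * a) / 2 := by
    have : 0 ≤ 1 - 2 * a := by linarith
    gcongr
  have hs4 : (1 - 2 * a) * s / 4 - s * s * (1 - 2 * a) / 2 ≤ (1 - 2 * a) / 32 := by
    nlinarith [mul_nonneg (by linarith : 0 ≤ 1 - 2 * a) (sq_nonneg (s - 1 / 4))]
  have hD : s * (1 - s) ≤ 1 / 4 := by nlinarith [sq_nonneg (s - 1 / 2)]
  have hDc : (7 / 8 - 5 / 8 * a - 9 / 4 * a ^ 2) * (s * (1 - s))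
      ≤ (7 / 8 - 5 / 8 * a - 9 / 4 * a ^ 2) * (1 / 4) := by
    have : 0 ≤ 7 / 8 - 5 / 8 * a - 9 / 4 * a ^ 2 := by nlinarith
    gcongr
  have hσD : (1 + 2 * a) / 100 * (s * (1 - s)) ≤ (1 + 2 * a) / 100 * (1 / 4) := by gcongr
  have hKν : ((3 + 3 * a - 2 * a ^ 2) / 2 + (1 + 2 * a) / 100) * ν
      ≤ ((3 + 3 * a - 2 * a ^ 2) / 2 + (1 + 2 * a) / 100) * (1 / 200) := by
    have : 0 ≤ (3 + 3 * a - 2 * a ^ 2) / 2 + (1 + 2 * a) / 100 := by nlinarith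
    gcongr
  linarith [profile_V_poly ha ha2]

/-- Positivity of the leading part of `⟨u, □u⟩`. -/
lemma profile_V_pos (ha : 0 < a) (ha2 : a < 1 / 2) (hγ : γ * (1 + 2 * a) = (1 + a) * (1 - 2 * a))
    (hγ0 : 0 < γ) (hν0 : 0 < ν) (hν : ν ≤ 1 / 200)
    (hs0 : 0 ≤ s) (hw : w = 1 - (1 - ν) * s) (hWQ : w * W = 1 - γ * Q)
    (hW : 1 ≤ W) (hQ : (1 - ν) * s ≤ Q)
    (hT : (1 - s) * Q ≤ 27 / 100 + 5 / 6 * (s * (1 - s) + ν)) :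
    (1 + 2 * a) * ((2 + 2 * a) * ((1 - s) * ((1 + γ / 2 + 1 / 100) * (1 - ν) * s * W
          - s * (2 + a) / 2 + 1 / 100 + (1 + a) * (1 + γ / 2 + 1 / 100) * Q) - s)
        + (1 + 2 * a) * (γ / 100 / (1 + a) + (1 + γ / 2 + 1 / 100) * (γ * Q) - γ / 2 * s)) < 3 := by
  have hg' : 1 ≤ (1 + γ / 2 + 1 / 100) * (1 - ν) := by nlinarith
  have hQs : s ≤ (1 + γ / 2 + 1 / 100) * Q := by
    calc s ≤ (1 + γ / 2 + 1 / 100) * (1 - ν) * s := by nlinarith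
      _ ≤ _ := by rw [mul_assoc]; gcongr
  have hνW : 0 ≤ (1 + 2 * a) * (1 + γ / 2 + 1 / 100) * s * (ν * W) := by positivity
  have hG := profile_V_estimate ha ha2 hν hs0 hQs hT
  have hd : γ / 100 / (1 + a) * (1 + 2 * a) = (1 - 2 * a) / 100 := by
    field_simp
    linarith
  have hfin : 2 * (1 + a) * ((1 - 2 * a) * s / 4
          + 3 / 2 * ((3 + 3 * a - 2 * a ^ 2) / 2 + (1 + 2 * a) / 100) * ((1 - s) * Q)
          - (1 + γ / 2 + 1 / 100) * Q * s * (1 - 2 * a) / 2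
          - (1 + 2 * a) * (2 + a) / 2 * (s * (1 - s)) + (1 + 2 * a) / 100
          - (1 + 2 * a) * (1 + γ / 2 + 1 / 100) * s * (ν * W))
        ≤ 2 * (1 + a) * ((3 / 2 - 1 / 10) / (1 + a)) := by
    gcongr
    linarith
  rw [profile_V_identity hγ hd rfl hw hWQ]
  have : 2 * (1 + a) * ((3 / 2 - 1 / 10) / (1 + a)) = 14 / 5 := by
    field_simp
    norm_num
  have : (1 + 2 * a) * (1 - 2 * a) / 100 < 1 / 100 := by nlinarith
  linarith

/-- The rescaled `h` dominates the contribution of the self-similar phase. -/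
lemma profile_h_gt (ha : 0 < a) (ha2 : a < 1 / 2)
    (hγ0 : 0 < γ) (hν0 : 0 < ν) (hν : ν ≤ 1 / 200)
    (hs0 : 0 ≤ s) (hs1 : s ≤ 1) (hW : 1 ≤ W) (hQ : (1 - ν) * s ≤ Q) :
    2 / (3 - (1 + 2 * a) * s) < ((1 + γ / 2 + 1 / 100) * (γ * (1 - ν) * W) - γ / 2) / (1 + a)
      + ((1 + γ / 2 + 1 / 100) * (1 - ν) * s * W - s * (2 + a) / 2 + 1 / 100
          + (1 + a) * (1 + γ / 2 + 1 / 100) * Q) + 1 := by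
  have hg' : 1 ≤ (1 + γ / 2 + 1 / 100) * (1 - ν) := by nlinarith
  have hQs : s ≤ (1 + γ / 2 + 1 / 100) * Q := by
    calc s ≤ (1 + γ / 2 + 1 / 100) * (1 - ν) * s := by nlinarith
      _ ≤ _ := by rw [mul_assoc]; gcongr
  have hgW : 1 ≤ (1 + γ / 2 + 1 / 100) * (1 - ν) * W := by nlinarith
  have h1 : 0 ≤ ((1 + γ / 2 + 1 / 100) * (γ * (1 - ν) * W) - γ / 2) / (1 + a) := by
    apply div_nonneg _ (by linarith)
    nlinarith
  have h2 : s ≤ (1 + γ / 2 + 1 / 100) * (1 - ν) * s * W := by nlinarith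
  have h3 : (1 + a) * s ≤ (1 + a) * (1 + γ / 2 + 1 / 100) * Q := by
    rw [mul_assoc]
    gcongr
  have h4 : 2 / (3 - (1 + 2 * a) * s) ≤ 1 + s := by
    rw [div_le_iff₀ (by nlinarith)]
    nlinarith [mul_nonneg hs0 (sub_nonneg.2 hs1), mul_nonneg (mul_nonneg hs0 hs0) ha.le,
      mul_nonneg hs0 (mul_nonneg hs0 (sub_nonneg.2 ha2.le)), mul_nonneg hs0 (sub_nonneg.2 ha2.le)]
  nlinarith

end Profile

section ProfileExistence

variable {a : ℝ}

set_option maxHeartbeats 1000000 in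
/-- Existence of the radial profiles of the stress-energy tensor. -/
lemma exists_profile {κ : ℝ} (ha : 0 < a) (ha2 : a < 1 / 2) (hκ : 3 * κ = 1 + 2 * a) :
    ∃ (e g h : ℝ → ℝ) (R : ℝ), 1 < R ∧ ContDiffOn ℝ ∞ e (Set.Iio R) ∧
      ContDiffOn ℝ ∞ g (Set.Iio R) ∧ ContDiffOn ℝ ∞ h (Set.Iio R) ∧
      (∀ s < R, e s = g s + s * h s) ∧
      (∀ s < R, κ + e s - (1 - s) * deriv e s - 2 * deriv g s
        + 2 * (1 + a) * (-(a + 3 / 2) * (κ + e s) + (1 - s) * deriv e s + h s) = 0) ∧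
      ∀ s, 0 ≤ s → s ≤ 1 → 0 < g s ∧ 0 < 1 + κ * s - (1 - s) * e s - 2 * g s ∧
        κ ^ 2 / (1 - κ * s) < h s := by
  obtain ⟨γ, hγ⟩ : ∃ γ, γ = (1 + a) * (1 - 2 * a) / (1 + 2 * a) := ⟨_, rfl⟩
  have h12 : 0 < 1 - 2 * a := by linarith
  have hγ0 : 0 < γ := by rw [hγ]; positivity
  have hγ1 : γ < 1 := by rw [hγ, div_lt_one (by linarith)]; nlinarith
  replace hγ : γ * (1 + 2 * a) = (1 + a) * (1 - 2 * a) := by rw [hγ]; field_simp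
  obtain ⟨ν, hν0, hν, hνγ⟩ : ∃ ν : ℝ, 0 < ν ∧ ν ≤ 1 / 200 ∧ ν ^ γ ≤ 1 / 200 := by
    refine ⟨min (1 / 200) ((1 / 200 : ℝ) ^ (1 / γ)), by positivity, min_le_left _ _, ?_⟩
    calc (min (1 / 200) ((1 / 200 : ℝ) ^ (1 / γ))) ^ γ ≤ ((1 / 200 : ℝ) ^ (1 / γ)) ^ γ := by
          gcongr
          exact min_le_right _ _
      _ = 1 / 200 := by
          rw [← Real.rpow_mul (by norm_num), one_div_mul_cancel hγ0.ne', Real.rpow_one]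
  set l := 1 + γ / 2 + 1 / 100 with hl
  set R := 1 / (1 - ν) with hR
  have hwpos : ∀ s < R, 0 < 1 - (1 - ν) * s := by
    intro s hs
    rw [hR, lt_div_iff₀ (by linarith)] at hs
    linarith
  set X : ℝ → ℝ := fun s => κ * (a + 1 / 2) * (γ / 100 / (1 + a)
    + l * (1 - (1 - (1 - ν) * s) ^ γ) - γ / 2 * s) with hX
  set X' : ℝ → ℝ := fun s => κ * (a + 1 / 2) * (l * (γ * (1 - ν) * (1 - (1 - ν) * s) ^ (γ - 1))
    - γ / 2) with hX'
  set e : ℝ → ℝ := fun s => (s * X' s + (1 + a) * X s) / ((1 + a) * (1 - 2 * a) / 2) with he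
  set g : ℝ → ℝ := fun s => (a + 1 / 2) * ((1 - s) * e s - κ * s) + X s with hg
  set h : ℝ → ℝ := fun s => X' s / (1 + a) + (a + 1 / 2) * (e s + κ) with hh
  have hrp : ∀ r : ℝ, ContDiffOn ℝ ∞ (fun s : ℝ => (1 - (1 - ν) * s) ^ r) (Set.Iio R) := by
    intro r
    refine ContDiffOn.rpow_const_of_ne ?_ fun s hs => (hwpos s hs).ne'
    fun_prop
  have hXs : ContDiffOn ℝ ∞ X (Set.Iio R) := by
    have := hrp γ
    fun_prop
  have hXs' : ContDiffOn ℝ ∞ X' (Set.Iio R) := by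
    have := hrp (γ - 1)
    fun_prop
  have hes : ContDiffOn ℝ ∞ e (Set.Iio R) := by
    refine ContDiffOn.div_const ?_ _
    fun_prop
  have hXd : ∀ s < R, HasDerivAt X (X' s) s := by
    intro s hs
    have h1 : HasDerivAt (fun s : ℝ => 1 - (1 - ν) * s) (-(1 - ν)) s := by
      simpa using ((hasDerivAt_id s).const_mul (1 - ν)).const_sub 1
    have h2 := h1.rpow_const (p := γ) (Or.inl (hwpos s hs).ne')
    have h3 := ((((h2.const_sub 1).const_mul l).const_add (γ / 100 / (1 + a))).sub
      ((hasDerivAt_id s).const_mul (γ / 2))).const_mul (κ * (a + 1 / 2))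
    refine h3.congr_deriv ?_
    simp only [hX']
    ring
  have hed : ∀ s < R, HasDerivAt e (deriv e s) s := fun s hs =>
    ((hes.differentiableOn (by simp)).differentiableAt (Iio_mem_nhds hs)).hasDerivAt
  refine ⟨e, g, h, R, ?_, hes, ?_, ?_, ?_, ?_, ?_⟩
  · rw [hR, lt_div_iff₀ (by linarith)]
    linarith
  · fun_prop
  · refine ContDiffOn.add (hXs'.div_const _) ?_
    fun_prop
  · intro s hs
    have hc : e s * ((1 + a) * (1 - 2 * a) / 2) = s * X' s + (1 + a) * X s := by
      exact div_mul_cancel₀ _ (by positivity)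
    have hq : X' s = X' s / (1 + a) * (1 + a) := by field_simp
    have hc' : e s * ((1 - 2 * a) / 2) = s * (X' s / (1 + a)) + X s := by
      refine mul_right_cancel₀ (by positivity : (1 + a) ≠ 0) ?_
      linear_combination hc + s * hq
    simp only [hg, hh]
    linear_combination hc'
  · intro s hs
    have hgd : HasDerivAt g ((a + 1 / 2) * (-e s + (1 - s) * deriv e s - κ) + X' s) s := by
      have h1 := (((((hasDerivAt_id s).const_sub 1).mul (hed s hs)).sub
        ((hasDerivAt_id s).const_mul κ)).const_mul (a + 1 / 2)).add (hXd s hs)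
      refine h1.congr_deriv ?_
      simp
    rw [hgd.deriv]
    simp only [hh]
    field_simp
    ring
  · intro s hs0 hs1
    have hw : 0 < 1 - (1 - ν) * s := by nlinarith
    have hνw : ν ≤ 1 - (1 - ν) * s := by nlinarith
    have hw1 : 1 - (1 - ν) * s ≤ 1 := by nlinarith
    obtain ⟨w, hwe⟩ : ∃ w, w = 1 - (1 - ν) * s := ⟨_, rfl⟩
    obtain ⟨W, hW⟩ : ∃ W, W = w ^ (γ - 1) := ⟨_, rfl⟩
    obtain ⟨Q, hQ⟩ : ∃ Q, Q = (1 - w ^ γ) / γ := ⟨_, rfl⟩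
    rw [← hwe] at hw hνw hw1
    have hγQ : 1 - w ^ γ = γ * Q := by rw [hQ]; field_simp
    have hWQ : w * W = 1 - γ * Q := by
      rw [← hγQ, hW, Real.rpow_sub_one hw.ne']
      field_simp
      ring
    have hW1 : 1 ≤ W := by
      rw [hW]
      exact Real.one_le_rpow_of_pos_of_le_one_of_nonpos hw hw1 (by linarith)
    have hνW : ν * W ≤ 1 / 200 := by
      refine le_trans ?_ hνγ
      calc ν * W ≤ ν * ν ^ (γ - 1) := by
            rw [hW]
            gcongr ν * ?_
            exact Real.rpow_le_rpow_of_nonpos hν0 hνw (by linarith)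
        _ = ν ^ γ := by
            rw [Real.rpow_sub_one hν0.ne']
            field_simp
    have hQs : (1 - ν) * s ≤ Q := by
      rw [hQ, le_div_iff₀ hγ0]
      have := rpow_one_add_le_one_add_mul_self (s := -((1 - ν) * s)) (by linarith) hγ0.le hγ1.le
      rw [← sub_eq_add_neg, ← hwe] at this
      linarith
    have hQ0 : 0 ≤ Q := le_trans (mul_nonneg (by linarith) hs0) hQs
    have hT : (1 - s) * Q ≤ 27 / 100 + 5 / 6 * (s * (1 - s) + ν) := by
      have h1 : (1 - s) * Q ≤ w * Q := by
        gcongr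
        rw [hwe]
        nlinarith
      have h2 := one_sub_rpow_le hw hγ0
      rw [← hQ] at h2
      have hx4 : (w ^ (1 / 4 : ℝ)) ^ 4 = w := by
        rw [← Real.rpow_natCast, ← Real.rpow_mul hw.le]
        norm_num
      have h3 := quartic_bound (Real.rpow_nonneg hw.le (1 / 4 : ℝ))
        (Real.rpow_le_one hw.le hw1 (by norm_num))
      rw [hx4] at h3
      have h4 : w * (1 - w) ≤ s * (1 - s) + ν := by
        rw [hwe]
        nlinarith [mul_nonneg hs0 (sub_nonneg.2 hs1), mul_nonneg hν0.le hs0,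
          mul_nonneg (mul_nonneg hν0.le hs0) (sub_nonneg.2 hs1),
          mul_nonneg (mul_nonneg hν0.le hν0.le) (mul_nonneg hs0 hs0)]
      linarith
    have Pg := profile_g_pos ha ha2 hγ0 hγ1 hν0 hν hs0 hs1 hwe hWQ hνW hQs
    have PV := profile_V_pos ha ha2 hγ hγ0 hν0 hν hs0 hwe hWQ hW1 hQs hT
    have Ph := profile_h_gt ha ha2 hγ0 hν0 hν hs0 hs1 hW1 hQs
    rw [← hl] at Pg PV Ph
    obtain ⟨E, hE⟩ : ∃ E, E = l * (1 - ν) * s * W - s * (2 + a) / 2 + 1 / 100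
      + (1 + a) * l * Q := ⟨_, rfl⟩
    rw [← hE] at Pg PV Ph
    have hXv : X s = κ * (a + 1 / 2) * (γ / 100 / (1 + a) + l * (γ * Q) - γ / 2 * s) := by
      simp only [hX]
      rw [← hwe, hγQ]
    have hXv' : X' s = κ * (a + 1 / 2) * (l * (γ * (1 - ν) * W) - γ / 2) := by
      simp only [hX']
      rw [← hwe, ← hW]
    have hev : e s = κ * E := by
      simp only [he]
      have hr : γ / 100 / (1 + a) * (1 + a) = γ / 100 := by field_simp
      rw [div_eq_iff (by positivity), hXv, hXv']
      linear_combination κ * (a + 1 / 2) * (hr - γ * hE) + κ * E / 2 * hγ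
    have hgv : g s = κ * (a + 1 / 2)
        * ((1 - s) * E - s + (γ / 100 / (1 + a) + l * (γ * Q) - γ / 2 * s)) := by
      simp only [hg]
      rw [hev, hXv]
      ring
    have hhv : h s = κ * (a + 1 / 2)
        * ((l * (γ * (1 - ν) * W) - γ / 2) / (1 + a) + E + 1) := by
      simp only [hh]
      rw [hev, hXv']
      ring
    have hκ0 : 0 < κ := by linarith
    have hκ' : κ = (1 + 2 * a) / 3 := by linarith
    refine ⟨?_, ?_, ?_⟩
    · rw [hgv]
      positivity
    · rw [hgv, hev]
      linarith [congrArg (fun t => t * ((2 + 2 * a) * ((1 - s) * E - s)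
        + (1 + 2 * a) * (γ / 100 / (1 + a) + l * (γ * Q) - γ / 2 * s))) hκ]
    · have hden : 0 < 3 - (1 + 2 * a) * s := by nlinarith
      have : κ ^ 2 / (1 - κ * s) = κ * (a + 1 / 2) * (2 / (3 - (1 + 2 * a) * s)) := by
        have : 1 - κ * s = (3 - (1 + 2 * a) * s) / 3 := by linear_combination -s / 3 * hκ
        rw [this]
        field_simp
        linear_combination hκ
      rw [this, hhv]
      gcongr

end ProfileExistence

section Components

/-- A smooth function on an open interval has a smooth antiderivative there. -/
lemma exists_antideriv {f : ℝ → ℝ} {l r c : ℝ} (hc : c ∈ Set.Ioo l r)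
    (hf : ContDiffOn ℝ ∞ f (Set.Ioo l r)) :
    ∃ F : ℝ → ℝ, ContDiffOn ℝ ∞ F (Set.Ioo l r) ∧ ∀ s ∈ Set.Ioo l r, HasDerivAt F (f s) s := by
  have hd : ∀ s ∈ Set.Ioo l r, HasDerivAt (fun s => ∫ x in c..s, f x) (f s) s := by
    intro s hs
    have hsub : Set.uIcc c s ⊆ Set.Ioo l r := Set.OrdConnected.uIcc_subset Set.ordConnected_Ioo hc hs
    refine intervalIntegral.integral_hasDerivAt_right
      (hf.continuousOn.mono hsub).intervalIntegrable ?_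
      (hf.continuousOn.continuousAt (isOpen_Ioo.mem_nhds hs))
    exact hf.continuousOn.stronglyMeasurableAtFilter isOpen_Ioo s hs
  refine ⟨_, ?_, hd⟩
  rw [contDiffOn_infty_iff_deriv_of_isOpen isOpen_Ioo]
  refine ⟨fun s hs => (hd s hs).differentiableAt.differentiableWithinAt, ?_⟩
  exact hf.congr fun s hs => (hd s hs).deriv

variable {a κ : ℝ}

/-- Amplitudes and phases realising the radial profiles of the stress-energy tensor. -/
lemma exists_components (ha : 0 < a) (ha2 : a < 1 / 2) (hκ : 3 * κ = 1 + 2 * a) :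
    ∃ (e g h B C ψ : ℝ → ℝ) (l r ε m₀ : ℝ), l < 0 ∧ 1 < r ∧ 0 < ε ∧
      ContDiffOn ℝ ∞ e (Set.Ioo l r) ∧ ContDiffOn ℝ ∞ g (Set.Ioo l r) ∧
      ContDiffOn ℝ ∞ h (Set.Ioo l r) ∧ ContDiffOn ℝ ∞ B (Set.Ioo l r) ∧
      ContDiffOn ℝ ∞ C (Set.Ioo l r) ∧ ContDiffOn ℝ ∞ ψ (Set.Ioo l r) ∧
      (∀ s ∈ Set.Ioo l r, e s = g s + s * h s) ∧
      (∀ s ∈ Set.Ioo l r, κ + e s - (1 - s) * deriv e s - 2 * deriv g s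
        + 2 * (1 + a) * (-(a + 3 / 2) * (κ + e s) + (1 - s) * deriv e s + h s) = 0) ∧
      (∀ s ∈ Set.Ioo l r, 0 < 1 - κ * s) ∧
      (∀ s ∈ Set.Ioo l r, ε + 3 * ε * B s ^ 2 + ε * C s ^ 2 = m₀) ∧
      (∀ s ∈ Set.Ioo l r, g s = ε * κ + B s ^ 2) ∧
      (∀ s ∈ Set.Ioo l r, h s = 12 * ε * deriv B s ^ 2 + 4 * ε * deriv C s ^ 2
        + 4 * ε * C s ^ 2 * deriv ψ s ^ 2 + κ ^ 2 * (1 + ε) / (1 - κ * s)) ∧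
      ∀ s, 0 ≤ s → s ≤ 1 → a * (a + 1) * m₀ < 1 + κ * s - (1 - s) * e s - 2 * g s := by
  obtain ⟨e, g, h, R, hR, hes, hgs, hhs, heq, hode, hpos⟩ := exists_profile ha ha2 hκ
  have hκ0 : 0 < κ := by linarith
  have hκ1 : κ < 1 := by linarith
  have hIR : Set.Icc (0 : ℝ) 1 ⊆ Set.Iio R := fun s hs => lt_of_le_of_lt hs.2 hR
  have hdg : ContDiffOn ℝ ∞ (deriv g) (Set.Iio R) :=
    ((contDiffOn_infty_iff_deriv_of_isOpen isOpen_Iio).1 hgs).2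
  have hdpos : ∀ s ∈ Set.Icc (0 : ℝ) 1, 0 < 1 - κ * s := fun s hs => by nlinarith [hs.1, hs.2]
  -- bounds from compactness
  obtain ⟨g₀, hg₀, hgl⟩ : ∃ c, 0 < c ∧ ∀ s ∈ Set.Icc (0 : ℝ) 1, c ≤ g s := by
    obtain ⟨x, hx, hm⟩ := isCompact_Icc.exists_isMinOn (Set.nonempty_Icc.2 zero_le_one)
      (hgs.continuousOn.mono hIR)
    exact ⟨g x, (hpos x hx.1 hx.2).1, fun s hs => hm hs⟩
  obtain ⟨v₀, hv₀, hvl⟩ : ∃ c, 0 < c ∧ ∀ s ∈ Set.Icc (0 : ℝ) 1,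
      c ≤ 1 + κ * s - (1 - s) * e s - 2 * g s := by
    have hc : ContinuousOn (fun s => 1 + κ * s - (1 - s) * e s - 2 * g s) (Set.Icc 0 1) := by
      have h1 := hgs.continuousOn.mono hIR
      have h2 := hes.continuousOn.mono hIR
      fun_prop
    obtain ⟨x, hx, hm⟩ := isCompact_Icc.exists_isMinOn (Set.nonempty_Icc.2 zero_le_one) hc
    exact ⟨_, (hpos x hx.1 hx.2).2.1, fun s hs => hm hs⟩
  obtain ⟨η, hη, hηl⟩ : ∃ c, 0 < c ∧ ∀ s ∈ Set.Icc (0 : ℝ) 1,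
      c ≤ h s - κ ^ 2 / (1 - κ * s) := by
    have hc : ContinuousOn (fun s => h s - κ ^ 2 / (1 - κ * s)) (Set.Icc 0 1) := by
      have h1 := hhs.continuousOn.mono hIR
      have h2 : ContinuousOn (fun s => κ ^ 2 / (1 - κ * s)) (Set.Icc 0 1) :=
        continuousOn_const.div (by fun_prop) fun s hs => (hdpos s hs).ne'
      fun_prop
    obtain ⟨x, hx, hm⟩ := isCompact_Icc.exists_isMinOn (Set.nonempty_Icc.2 zero_le_one) hc
    exact ⟨_, sub_pos.2 (hpos x hx.1 hx.2).2.2, fun s hs => hm hs⟩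
  obtain ⟨G, hG⟩ : ∃ G, ∀ s ∈ Set.Icc (0 : ℝ) 1, g s ≤ G := by
    obtain ⟨G, hG⟩ := isCompact_Icc.bddAbove_image (hgs.continuousOn.mono hIR)
    exact ⟨G, fun s hs => hG ⟨s, hs, rfl⟩⟩
  obtain ⟨D, hD⟩ : ∃ D, ∀ s ∈ Set.Icc (0 : ℝ) 1, deriv g s ^ 2 ≤ D := by
    obtain ⟨G, hG⟩ := isCompact_Icc.bddAbove_image ((hdg.continuousOn.mono hIR).pow 2)
    exact ⟨G, fun s hs => hG ⟨s, hs, rfl⟩⟩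
  have hG0 : 0 < G := lt_of_lt_of_le hg₀ ((hgl 0 (by simp)).trans (hG 0 (by simp)))
  have hD0 : 0 ≤ D := (sq_nonneg _).trans (hD 0 (by simp))
  obtain ⟨L, hL⟩ : ∃ L, L = 2 + 3 * G := ⟨_, rfl⟩
  -- choice of the small parameter
  obtain ⟨ε, hε, hε1, hε2, hε3⟩ : ∃ ε : ℝ, 0 < ε ∧ ε * κ ≤ g₀ / 2 ∧ a * (a + 1) * (ε * L) < v₀ ∧
      ε * (κ ^ 2 / (1 - κ) + 6 * D / g₀ + 9 * D) < η := by
    have hlim : ∀ K c : ℝ, 0 < c → ∀ᶠ ε in nhdsWithin (0 : ℝ) (Set.Ioi 0), ε * K < c := by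
      intro K c hc
      have : Filter.Tendsto (fun ε : ℝ => ε * K) (nhdsWithin 0 (Set.Ioi 0)) (nhds 0) := by
        have h1 : Filter.Tendsto (fun ε : ℝ => ε * K) (nhds 0) (nhds (0 * K)) :=
          (continuous_id.mul continuous_const).tendsto 0
        rw [zero_mul] at h1
        exact h1.mono_left nhdsWithin_le_nhds
      exact this.eventually (gt_mem_nhds hc)
    obtain ⟨ε, ⟨⟨h1, h2⟩, h3⟩, h4⟩ := (((hlim κ (g₀ / 2) (by linarith)).and
      (hlim (a * (a + 1) * L) v₀ hv₀)).and
      (hlim (κ ^ 2 / (1 - κ) + 6 * D / g₀ + 9 * D) η hη)).and self_mem_nhdsWithin |>.exists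
    exact ⟨ε, h4, h1.le, by linarith, h3⟩
  set b : ℝ → ℝ := fun s => g s - ε * κ with hb
  set c : ℝ → ℝ := fun s => L - 1 - 3 * b s with hc
  set Y : ℝ → ℝ := fun s => h s - κ ^ 2 * (1 + ε) / (1 - κ * s) - 3 * ε * deriv g s ^ 2 / b s
    - 9 * ε * deriv g s ^ 2 / c s with hY
  have hbpos : ∀ s ∈ Set.Icc (0 : ℝ) 1, g₀ / 2 ≤ b s := fun s hs => by
    have := hgl s hs
    simp only [hb]
    linarith
  have hcpos : ∀ s ∈ Set.Icc (0 : ℝ) 1, 1 ≤ c s := fun s hs => by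
    have := hG s hs
    have : 0 < ε * κ := by positivity
    simp only [hc, hb]
    linarith
  have hYpos : ∀ s ∈ Set.Icc (0 : ℝ) 1, 0 < Y s := fun s hs => by
    have h1 := hηl s hs
    have h2 : κ ^ 2 / (1 - κ * s) ≤ κ ^ 2 / (1 - κ) := by
      have := hs.2
      gcongr
      nlinarith
    have h3 : 3 * ε * deriv g s ^ 2 / b s ≤ 3 * ε * D / (g₀ / 2) := by
      gcongr
      · exact hD s hs
      · exact hbpos s hs
    have h4 : 9 * ε * deriv g s ^ 2 / c s ≤ 9 * ε * D / 1 := by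
      gcongr
      · exact hD s hs
      · exact hcpos s hs
    have h5 : 3 * ε * D / (g₀ / 2) = ε * (6 * D / g₀) := by
      field_simp
      ring
    have h6 : κ ^ 2 * (1 + ε) / (1 - κ * s)
        = κ ^ 2 / (1 - κ * s) + ε * (κ ^ 2 / (1 - κ * s)) := by ring
    have h7 : ε * (κ ^ 2 / (1 - κ * s)) ≤ ε * (κ ^ 2 / (1 - κ)) := by gcongr
    simp only [hY]
    rw [h6]
    linarith
  have hbs : ContDiffOn ℝ ∞ b (Set.Iio R) := hgs.sub contDiffOn_const
  have hcs : ContDiffOn ℝ ∞ c (Set.Iio R) := by fun_prop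
  -- an interval on which everything stays positive
  obtain ⟨δ, hδ, hW⟩ : ∃ δ > 0, ∀ s ∈ Set.Ioo (-δ) (1 + δ),
      s < R ∧ 0 < 1 - κ * s ∧ 0 < b s ∧ 0 < c s ∧ 0 < Y s := by
    have hev : ∀ᶠ s in nhdsSet (Set.Icc (0 : ℝ) 1),
        s < R ∧ 0 < 1 - κ * s ∧ 0 < b s ∧ 0 < c s ∧ 0 < Y s := by
      rw [eventually_nhdsSet_iff_forall]
      intro s hs
      have hRs : Set.Iio R ∈ nhds s := Iio_mem_nhds (hIR hs)
      have c1 := hbs.continuousOn.continuousAt hRs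
      have c2 := hcs.continuousOn.continuousAt hRs
      have c3 := hhs.continuousOn.continuousAt hRs
      have c4 := hdg.continuousOn.continuousAt hRs
      have c0 : ContinuousAt (fun s => 1 - κ * s) s := by fun_prop
      have hb0 : b s ≠ 0 := by linarith [hbpos s hs]
      have hc0 : c s ≠ 0 := by linarith [hcpos s hs]
      have c5 : ContinuousAt Y s := by
        have := (hdpos s hs).ne'
        fun_prop (disch := assumption)
      filter_upwards [hRs, c0.eventually (lt_mem_nhds (hdpos s hs)),
        c1.eventually (lt_mem_nhds (by linarith [hbpos s hs] : 0 < b s)),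
        c2.eventually (lt_mem_nhds (by linarith [hcpos s hs] : 0 < c s)),
        c5.eventually (lt_mem_nhds (hYpos s hs))] with x h1 h2 h3 h4 h5
      exact ⟨h1, h2, h3, h4, h5⟩
    obtain ⟨W, hWo, hIW, hW⟩ := mem_nhdsSet_iff_exists.1 hev
    obtain ⟨δ, hδ, hsub⟩ := isCompact_Icc.exists_thickening_subset_open hWo hIW
    refine ⟨δ, hδ, fun s hs => hW (hsub ?_)⟩
    rw [Metric.mem_thickening_iff]
    refine ⟨max 0 (min s 1), ⟨le_max_left _ _, max_le zero_le_one (min_le_right _ _)⟩, ?_⟩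
    rw [Real.dist_eq, abs_lt]
    rcases le_total s 0 with h0 | h0
    · rw [max_eq_left ((min_le_left _ _).trans h0)]
      constructor <;> linarith [hs.1]
    · rcases le_total s 1 with h1 | h1
      · rw [min_eq_left h1, max_eq_right h0]
        constructor <;> linarith
      · rw [min_eq_right h1, max_eq_right zero_le_one]
        constructor <;> linarith [hs.2]
  set U := Set.Ioo (-δ) (1 + δ) with hU
  have hUo : IsOpen U := isOpen_Ioo
  have hUR : U ⊆ Set.Iio R := fun s hs => (hW s hs).1
  have hYs : ContDiffOn ℝ ∞ Y U := by
    have h1 := hhs.mono hUR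
    have h2 := hdg.mono hUR
    have h3 := hbs.mono hUR
    have h4 := hcs.mono hUR
    have h5 : ContDiffOn ℝ ∞ (fun s => κ ^ 2 * (1 + ε) / (1 - κ * s)) U :=
      contDiffOn_const.div (by fun_prop) fun s hs => (hW s hs).2.1.ne'
    have h6 : ContDiffOn ℝ ∞ (fun s => 3 * ε * deriv g s ^ 2 / b s) U :=
      ContDiffOn.div (by fun_prop) h3 fun s hs => (hW s hs).2.2.1.ne'
    have h7 : ContDiffOn ℝ ∞ (fun s => 9 * ε * deriv g s ^ 2 / c s) U :=
      ContDiffOn.div (by fun_prop) h4 fun s hs => (hW s hs).2.2.2.1.ne'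
    exact ((h1.sub h5).sub h6).sub h7
  have hBs : ContDiffOn ℝ ∞ (fun s => √(b s)) U :=
    (hbs.mono hUR).sqrt fun s hs => (hW s hs).2.2.1.ne'
  have hCs : ContDiffOn ℝ ∞ (fun s => √(c s)) U :=
    (hcs.mono hUR).sqrt fun s hs => (hW s hs).2.2.2.1.ne'
  have hφs : ContDiffOn ℝ ∞ (fun s => √(Y s) / (2 * √ε * √(c s))) U := by
    refine (hYs.sqrt fun s hs => (hW s hs).2.2.2.2.ne').div (contDiffOn_const.mul hCs) ?_
    intro s hs
    have := (hW s hs).2.2.2.1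
    positivity
  obtain ⟨ψ, hψs, hψ⟩ := exists_antideriv (c := 0) ⟨by linarith, by linarith⟩ hφs
  refine ⟨e, g, h, fun s => √(b s), fun s => √(c s), ψ, -δ, 1 + δ, ε, ε * L, by linarith,
    by linarith, hε, hes.mono hUR, hgs.mono hUR, hhs.mono hUR, hBs, hCs, hψs,
    fun s hs => heq s (hUR hs), fun s hs => hode s (hUR hs), fun s hs => (hW s hs).2.1, ?_, ?_, ?_,
    ?_⟩
  · intro s hs
    obtain ⟨-, -, h1, h2, -⟩ := hW s hs
    rw [Real.sq_sqrt h1.le, Real.sq_sqrt h2.le]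
    ring
  · intro s hs
    obtain ⟨-, -, h1, h2, -⟩ := hW s hs
    rw [Real.sq_sqrt h1.le]
    simp only [hb]
    ring
  · intro s hs
    obtain ⟨-, h0, h1, h2, h3⟩ := hW s hs
    have hgd : HasDerivAt g (deriv g s) s :=
      ((hgs.differentiableOn (by simp)).differentiableAt (Iio_mem_nhds (hUR hs))).hasDerivAt
    have hbd : HasDerivAt b (deriv g s) s := hgd.sub_const _
    have hcd : HasDerivAt c (-(3 * deriv g s)) s := (hbd.const_mul 3).const_sub _
    rw [(hbd.sqrt h1.ne').deriv, (hcd.sqrt h2.ne').deriv, (hψ s hs).deriv, div_pow, div_pow,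
      div_pow, mul_pow, mul_pow, mul_pow, mul_pow, Real.sq_sqrt h1.le, Real.sq_sqrt h2.le,
      Real.sq_sqrt h3.le, Real.sq_sqrt hε.le]
    have : Y s = h s - κ ^ 2 * (1 + ε) / (1 - κ * s) - 3 * ε * deriv g s ^ 2 / b s
      - 9 * ε * deriv g s ^ 2 / c s := rfl
    have e1 : 4 * ε * c s * (Y s / (2 ^ 2 * ε * c s)) = Y s := by
      field_simp
      norm_num
    rw [e1, this]
    ring_nf
  · intro s h0 h1
    exact lt_of_lt_of_le hε2 (hvl s ⟨h0, h1⟩)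

end Components

section PolarSums

variable {ι F : Type*} [Fintype ι] [NormedAddCommGroup F] [InnerProductSpace ℝ F]
  {v : ι ⊕ ι → F} {d : ℕ}

lemma inner_pair_sum (hv : Orthonormal ℝ v) (x y x' y' : ι → ℝ) :
    ⟪∑ n, (x n • v (.inl n) + y n • v (.inr n)), ∑ n, (x' n • v (.inl n) + y' n • v (.inr n))⟫
      = ∑ n, (x n * x' n + y n * y' n) := by
  have h := hv.inner_sum (Sum.elim x y) (Sum.elim x' y') Finset.univ
  simpa [Fintype.sum_sum_type, Finset.sum_add_distrib] using h

/-- The map whose components in the planes spanned by `v (inl n)` and `v (inr n)` have polar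
coordinates `A n`, `φ n`. -/
def polarSum (v : ι ⊕ ι → F) (A φ : ι → Sp d → ℝ) (y : Sp d) : F :=
  ∑ n, ((A n y * cos (φ n y)) • v (.inl n) + (A n y * sin (φ n y)) • v (.inr n))

lemma inner_polarSum (hv : Orthonormal ℝ v) (A φ : ι → Sp d → ℝ) (y : Sp d) :
    ⟪polarSum v A φ y, polarSum v A φ y⟫ = ∑ n, A n y ^ 2 := by
  rw [polarSum, inner_pair_sum hv]
  refine Finset.sum_congr rfl fun n _ => ?_
  linear_combination A n y ^ 2 * sin_sq_add_cos_sq (φ n y)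

lemma contDiffOn_polarSum {A φ : ι → Sp d → ℝ} {Ω : Set (Sp d)}
    (hA : ∀ n, ContDiffOn ℝ ∞ (A n) Ω) (hφ : ∀ n, ContDiffOn ℝ ∞ (φ n) Ω) :
    ContDiffOn ℝ ∞ (polarSum v A φ) Ω := by
  refine ContDiffOn.sum fun n _ => ?_
  exact (((hA n).mul (hφ n).cos).smul contDiffOn_const).add
    (((hA n).mul (hφ n).sin).smul contDiffOn_const)

lemma hasPd_polarSum {A φ : ι → Sp d → ℝ} {A' φ' : ι → ℝ} {α : Fin (d + 1)} {y : Sp d}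
    (hA : ∀ n, HasPd α (A n) (A' n) y) (hφ : ∀ n, HasPd α (φ n) (φ' n) y) :
    HasPd α (polarSum v A φ)
      (∑ n, ((A' n * cos (φ n y) + A n y * (-sin (φ n y) * φ' n)) • v (.inl n)
        + (A' n * sin (φ n y) + A n y * (cos (φ n y) * φ' n)) • v (.inr n))) y :=
  HasPd.sum fun n _ =>
    (((hA n).mul ((hφ n).comp (hasDerivAt_cos _))).smul_const _).add
      (((hA n).mul ((hφ n).comp (hasDerivAt_sin _))).smul_const _)

lemma inner_pd_polarSum (hv : Orthonormal ℝ v) {A φ : ι → Sp d → ℝ} {A' φ' A'' φ'' : ι → ℝ}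
    {α β : Fin (d + 1)} {y : Sp d}
    (hA : ∀ n, HasPd α (A n) (A' n) y) (hφ : ∀ n, HasPd α (φ n) (φ' n) y)
    (hA' : ∀ n, HasPd β (A n) (A'' n) y) (hφ' : ∀ n, HasPd β (φ n) (φ'' n) y) :
    ⟪pd α (polarSum v A φ) y, pd β (polarSum v A φ) y⟫
      = ∑ n, (A' n * A'' n + A n y ^ 2 * (φ' n * φ'' n)) := by
  rw [(hasPd_polarSum hA hφ).pd_eq, (hasPd_polarSum hA' hφ').pd_eq, inner_pair_sum hv]
  refine Finset.sum_congr rfl fun n _ => ?_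
  linear_combination (A' n * A'' n + A n y ^ 2 * (φ' n * φ'' n)) * sin_sq_add_cos_sq (φ n y)

lemma inner_polarSum_inl (hv : Orthonormal ℝ v) (A φ : ι → Sp d → ℝ) (y : Sp d) (n : ι) :
    ⟪v (.inl n), polarSum v A φ y⟫ = A n y * cos (φ n y) := by
  classical
  simp [polarSum, inner_sum, inner_add_right, inner_smul_right, orthonormal_iff_ite.1 hv]

lemma inner_polarSum_inr (hv : Orthonormal ℝ v) (A φ : ι → Sp d → ℝ) (y : Sp d) (n : ι) :
    ⟪v (.inr n), polarSum v A φ y⟫ = A n y * sin (φ n y) := by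
  classical
  simp [polarSum, inner_sum, inner_add_right, inner_smul_right, orthonormal_iff_ite.1 hv]

end PolarSums

section SelfSimilarVariables

variable {y : Sp 3} {F : ℝ → ℝ} {F' : ℝ}

/-- The self-similar coordinate `x_j / t`. -/
def zc (j : Fin 3) (y : Sp 3) : ℝ := y j.succ * (y 0)⁻¹

/-- The self-similar radius squared `|x|² / t²`. -/
def sc (y : Sp 3) : ℝ := ∑ j, zc j y * zc j y

/-- The coordinate derivative `∂_α t`. -/
def dt (α : Fin 4) : ℝ := if 0 = α then 1 else 0

/-- `t ∂_α (x_j / t)`. -/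
def dz (α : Fin 4) (y : Sp 3) (j : Fin 3) : ℝ := (if j.succ = α then 1 else 0) - zc j y * dt α

/-- `t ∂_α (|x|² / t²)`. -/
def ds (α : Fin 4) (y : Sp 3) : ℝ := 2 * ∑ j, zc j y * dz α y j

lemma hasPd_zc (hy : 0 < y 0) (α : Fin 4) (j : Fin 3) :
    HasPd α (zc j) (dz α y j * (y 0)⁻¹) y := by
  have h := (HasPd.coord (y := y) (α := α) j.succ).mul
    ((HasPd.coord (α := α) 0).comp (hasDerivAt_inv hy.ne'))
  refine ⟨h.1, h.2.trans ?_⟩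
  simp only [dz, dt, zc]
  field_simp
  ring

lemma hasPd_sc (hy : 0 < y 0) (α : Fin 4) : HasPd α sc (ds α y * (y 0)⁻¹) y := by
  have h := HasPd.sum (s := Finset.univ) fun j _ => (hasPd_zc hy α j).mul (hasPd_zc hy α j)
  refine ⟨h.1, h.2.trans ?_⟩
  simp only [ds, Finset.mul_sum, Finset.sum_mul]
  exact Finset.sum_congr rfl fun j _ => by ring

lemma hasPd_rpow (hy : 0 < y 0) (α : Fin 4) (q : ℝ) :
    HasPd α (fun z : Sp 3 => z 0 ^ q) (y 0 ^ (q - 1) * (q * dt α)) y := by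
  have h := (HasPd.coord (y := y) (α := α) 0).comp (hasDerivAt_rpow_const (Or.inl hy.ne') (p := q))
  convert h using 1
  simp only [dt]
  ring

lemma rpow_mul_inv (hy : 0 < y 0) (q : ℝ) : y 0 ^ q * (y 0)⁻¹ = y 0 ^ (q - 1) := by
  rw [rpow_sub_one hy.ne', div_eq_mul_inv]

/-- Differentiating a function homogeneous of degree `q`. -/
lemma hasPd_rpow_mul (hy : 0 < y 0) {α : Fin 4} (q : ℝ) {f : Sp 3 → ℝ} {f' : ℝ}
    (hf : HasPd α f (f' * (y 0)⁻¹) y) :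
    HasPd α (fun z => z 0 ^ q * f z) (y 0 ^ (q - 1) * (q * dt α * f y + f')) y := by
  have h := (hasPd_rpow hy α q).mul hf
  convert h using 1
  rw [← rpow_mul_inv hy]
  ring

lemma hasPd_comp_sc (hy : 0 < y 0) (α : Fin 4) (hF : HasDerivAt F F' (sc y)) :
    HasPd α (fun z => F (sc z)) (F' * ds α y * (y 0)⁻¹) y := by
  rw [mul_assoc]
  exact (hasPd_sc hy α).comp hF

lemma sc_nonneg (y : Sp 3) : 0 ≤ sc y := Finset.sum_nonneg fun _ _ => mul_self_nonneg _

lemma sc_le_one (hy : y ∈ Cone 3) : sc y ≤ 1 := by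
  have h0 : 0 < y 0 := hy.1
  have h : sc y = (∑ j : Fin 3, y j.succ ^ 2) / y 0 ^ 2 := by
    rw [sc, Finset.sum_div]
    exact Finset.sum_congr rfl fun j _ => by simp only [zc]; field_simp
  rw [h, div_le_one (by positivity)]
  exact hy.2

lemma dt_zero : dt 0 = 1 := rfl

lemma dt_succ (i : Fin 3) : dt i.succ = 0 := if_neg (Fin.succ_ne_zero i).symm

lemma dz_zero (y : Sp 3) (j : Fin 3) : dz 0 y j = -zc j y := by
  simp [dz, dt]

lemma dz_succ (y : Sp 3) (i j : Fin 3) : dz i.succ y j = if j = i then 1 else 0 := by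
  simp [dz, dt_succ]

lemma ds_zero (y : Sp 3) : ds 0 y = -2 * sc y := by
  simp [ds, dz_zero, sc]

lemma ds_succ (y : Sp 3) (i : Fin 3) : ds i.succ y = 2 * zc i y := by
  simp [ds, dz_succ]

end SelfSimilarVariables

section Construction

/-- Index set of the eight planes: the rotating plane, the spare plane, and three planes each for
the twisted and the linear components. -/
abbrev PlaneIndex := Unit ⊕ Unit ⊕ Fin 3 ⊕ Fin 3

/-- The amplitudes in the eight planes, as functions of the self-similar variables. -/
def amp (η κ : ℝ) (B C : ℝ → ℝ) : PlaneIndex → Sp 3 → ℝ :=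
  Sum.elim (fun _ y => η * √(1 - κ * sc y)) (Sum.elim (fun _ y => η * C (sc y))
    (Sum.elim (fun _ y => η * B (sc y)) fun j y => η * √κ * zc j y))

/-- The phases in the eight planes. -/
def phase (η κ : ℝ) (ψ : ℝ → ℝ) : PlaneIndex → Sp 3 → ℝ :=
  Sum.elim (fun _ y => η⁻¹ * (log (y 0) + log (1 - κ * sc y) / 2)) (Sum.elim (fun _ y => ψ (sc y))
    (Sum.elim (fun j y => η⁻¹ * zc j y) fun _ _ => 0))

/-- The self-similar map with amplitudes `t ^ (-a) * amp` and phases `phase`. -/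
def ssMap {F : Type*} [NormedAddCommGroup F] [InnerProductSpace ℝ F]
    (v : PlaneIndex ⊕ PlaneIndex → F) (a η κ : ℝ) (B C ψ : ℝ → ℝ) : Sp 3 → F :=
  polarSum v (fun n y => y 0 ^ (-a) * amp η κ B C n y) (phase η κ ψ)

/-- `t ∂_α` of the amplitudes. -/
def damp (η κ B' C' : ℝ) (α : Fin 4) (y : Sp 3) : PlaneIndex → ℝ :=
  Sum.elim (fun _ => η * (-κ * ds α y / (2 * √(1 - κ * sc y)))) (Sum.elim (fun _ => η * (C' * ds α y))
    (Sum.elim (fun _ => η * (B' * ds α y)) fun j => η * √κ * dz α y j))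

/-- `t ∂_α` of the phases. -/
def dphase (η κ ψ' : ℝ) (α : Fin 4) (y : Sp 3) : PlaneIndex → ℝ :=
  Sum.elim (fun _ => η⁻¹ * (dt α - κ * ds α y / (2 * (1 - κ * sc y)))) (Sum.elim (fun _ => ψ' * ds α y)
    (Sum.elim (fun j => η⁻¹ * dz α y j) fun _ => 0))

variable {a η κ : ℝ} {B C ψ : ℝ → ℝ} {B' C' ψ' : ℝ} {y : Sp 3}

lemma hasPd_amp (hy : 0 < y 0) (hs : 0 < 1 - κ * sc y) (hB : HasDerivAt B B' (sc y))
    (hC : HasDerivAt C C' (sc y)) (α : Fin 4) (n : PlaneIndex) :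
    HasPd α (amp η κ B C n) (damp η κ B' C' α y n * (y 0)⁻¹) y := by
  have hlin : HasDerivAt (fun s => 1 - κ * s) (-κ) (sc y) := by
    simpa using ((hasDerivAt_id (sc y)).const_mul κ).const_sub 1
  rcases n with _ | _ | _ | j
  · have h := (hasPd_comp_sc hy α (hlin.sqrt hs.ne')).const_mul η
    refine ⟨h.1, h.2.trans ?_⟩
    simp only [damp, Sum.elim_inl]
    ring
  · have h := (hasPd_comp_sc hy α hC).const_mul η
    refine ⟨h.1, h.2.trans ?_⟩
    simp only [damp, Sum.elim_inl, Sum.elim_inr]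
    ring
  · have h := (hasPd_comp_sc hy α hB).const_mul η
    refine ⟨h.1, h.2.trans ?_⟩
    simp only [damp, Sum.elim_inl, Sum.elim_inr]
    ring
  · have h := (hasPd_zc hy α j).const_mul (η * √κ)
    refine ⟨h.1, h.2.trans ?_⟩
    simp only [damp, Sum.elim_inr]
    ring

lemma hasPd_phase (hy : 0 < y 0) (hs : 0 < 1 - κ * sc y) (hψ : HasDerivAt ψ ψ' (sc y))
    (α : Fin 4) (n : PlaneIndex) :
    HasPd α (phase η κ ψ n) (dphase η κ ψ' α y n * (y 0)⁻¹) y := by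
  have hlin : HasDerivAt (fun s => 1 - κ * s) (-κ) (sc y) := by
    simpa using ((hasDerivAt_id (sc y)).const_mul κ).const_sub 1
  rcases n with _ | _ | j | _
  · have h := (((HasPd.coord (y := y) (α := α) 0).comp (hasDerivAt_log hy.ne')).add
      (hasPd_comp_sc hy α ((hlin.log hs.ne').div_const 2))).const_mul η⁻¹
    refine ⟨h.1, h.2.trans ?_⟩
    simp only [dphase, Sum.elim_inl, dt]
    field_simp
    ring
  · have h := hasPd_comp_sc hy α hψ
    refine ⟨h.1, h.2.trans ?_⟩
    simp only [dphase, Sum.elim_inl, Sum.elim_inr]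
  · have h := (hasPd_zc hy α j).const_mul η⁻¹
    refine ⟨h.1, h.2.trans ?_⟩
    simp only [dphase, Sum.elim_inl, Sum.elim_inr]
    ring
  · have h := HasPd.const (y := y) (α := α) (0 : ℝ)
    refine ⟨h.1, h.2.trans ?_⟩
    simp [dphase]

lemma sum_amp_sq (hκ : 0 ≤ κ) (hs : 0 < 1 - κ * sc y) :
    ∑ n, amp η κ B C n y ^ 2
      = η ^ 2 + 3 * η ^ 2 * B (sc y) ^ 2 + η ^ 2 * C (sc y) ^ 2 := by
  have hz : sc y = ∑ j, zc j y * zc j y := rfl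
  rw [Fin.sum_univ_three] at hz
  simp only [amp, Fintype.sum_sum_type, Sum.elim_inl, Sum.elim_inr, Finset.univ_unique,
    Finset.sum_singleton, Fin.sum_univ_three, mul_pow, sq_sqrt hκ, sq_sqrt hs.le]
  linear_combination -η ^ 2 * κ * hz

lemma inner_ssMap {F : Type*} [NormedAddCommGroup F] [InnerProductSpace ℝ F]
    {v : PlaneIndex ⊕ PlaneIndex → F} (hv : Orthonormal ℝ v) (hy : 0 < y 0) (hκ : 0 ≤ κ)
    (hs : 0 < 1 - κ * sc y) :
    ⟪ssMap v a η κ B C ψ y, ssMap v a η κ B C ψ y⟫ = y 0 ^ (-2 * a)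
      * (η ^ 2 + 3 * η ^ 2 * B (sc y) ^ 2 + η ^ 2 * C (sc y) ^ 2) := by
  rw [ssMap, inner_polarSum hv, ← sum_amp_sq hκ hs, Finset.mul_sum]
  refine Finset.sum_congr rfl fun n _ => ?_
  rw [mul_pow, ← rpow_mul_natCast hy.le]
  ring_nf

/-- The Gram matrix `⟨∂_α u, ∂_β u⟩` of the self-similar map. -/
lemma inner_pd_ssMap {F : Type*} [NormedAddCommGroup F] [InnerProductSpace ℝ F]
    {v : PlaneIndex ⊕ PlaneIndex → F} (hv : Orthonormal ℝ v) (hy : 0 < y 0) (hη : 0 < η)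
    (hκ : 0 ≤ κ) (hs : 0 < 1 - κ * sc y) (hB : HasDerivAt B B' (sc y))
    (hC : HasDerivAt C C' (sc y)) (hψ : HasDerivAt ψ ψ' (sc y)) {m₀ g h : ℝ}
    (hm : η ^ 2 + 3 * η ^ 2 * B (sc y) ^ 2 + η ^ 2 * C (sc y) ^ 2 = m₀)
    (hm' : 3 * (B (sc y) * B') + C (sc y) * C' = 0)
    (hg : g = η ^ 2 * κ + B (sc y) ^ 2)
    (hh : h = 12 * η ^ 2 * B' ^ 2 + 4 * η ^ 2 * C' ^ 2 + 4 * η ^ 2 * C (sc y) ^ 2 * ψ' ^ 2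
      + κ ^ 2 * (1 + η ^ 2) / (1 - κ * sc y)) (α β : Fin 4) :
    ⟪pd α (ssMap v a η κ B C ψ) y, pd β (ssMap v a η κ B C ψ) y⟫ = y 0 ^ (-2 * a - 2)
      * ((m₀ * a ^ 2 + 1 - κ * sc y) * (dt α * dt β) - κ / 2 * (dt α * ds β y + dt β * ds α y)
        + g * ∑ j, dz α y j * dz β y j + h / 4 * (ds α y * ds β y)) := by
  rw [ssMap, inner_pd_polarSum hv
    (fun n => hasPd_rpow_mul hy (-a) (hasPd_amp hy hs hB hC α n)) (fun n => hasPd_phase hy hs hψ α n)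
    (fun n => hasPd_rpow_mul hy (-a) (hasPd_amp hy hs hB hC β n)) (fun n => hasPd_phase hy hs hψ β n)]
  have hpow : y 0 ^ (-2 * a - 2) = (y 0 ^ (-a) * (y 0)⁻¹) ^ 2 := by
    rw [rpow_mul_inv hy, ← rpow_mul_natCast hy.le]
    congr 1
    push_cast
    ring
  have hsum : ∀ A' A'' φ' φ'' b : ℝ,
      y 0 ^ (-a - 1) * (-a * dt α * b + A') * (y 0 ^ (-a - 1) * (-a * dt β * b + A''))
        + (y 0 ^ (-a) * b) ^ 2 * (φ' * (y 0)⁻¹ * (φ'' * (y 0)⁻¹)) = y 0 ^ (-2 * a - 2)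
      * ((-a * dt α * b + A') * (-a * dt β * b + A'') + b ^ 2 * (φ' * φ'')) := by
    intro A' A'' φ' φ'' b
    rw [hpow, ← rpow_mul_inv hy]
    ring
  simp only [hsum, ← Finset.mul_sum]
  congr 1
  have hD : ∀ P σ σ' τ τ' : ℝ, 0 < P →
      (-a * τ * (η * P) + η * (-κ * σ / (2 * P))) * (-a * τ' * (η * P) + η * (-κ * σ' / (2 * P)))
        + (η * P) ^ 2 * (η⁻¹ * (τ - κ * σ / (2 * P ^ 2)) * (η⁻¹ * (τ' - κ * σ' / (2 * P ^ 2))))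
      = a ^ 2 * τ * τ' * η ^ 2 * P ^ 2 + a * η ^ 2 * κ / 2 * (τ * σ' + τ' * σ)
        + P ^ 2 * τ * τ' - κ / 2 * (τ * σ' + τ' * σ)
        + κ ^ 2 * (1 + η ^ 2) / P ^ 2 * (σ * σ' / 4) := by
    intro P σ σ' τ τ' hP
    field_simp
    ring
  have hz : sc y = ∑ j, zc j y * zc j y := rfl
  have hσ : ∀ γ, ds γ y = 2 * ∑ j, zc j y * dz γ y j := fun _ => rfl
  have hDy := hD √(1 - κ * sc y) (ds α y) (ds β y) (dt α) (dt β) (sqrt_pos.2 hs)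
  rw [sq_sqrt hs.le] at hDy
  have hκ2 : √κ ^ 2 = κ := sq_sqrt hκ
  have hη1 : η * η⁻¹ = 1 := mul_inv_cancel₀ hη.ne'
  have hσα := hσ α
  have hσβ := hσ β
  rw [Fin.sum_univ_three] at hz hσα hσβ
  simp only [amp, damp, dphase, Fintype.sum_sum_type, Sum.elim_inl, Sum.elim_inr,
    Finset.univ_unique, Finset.sum_singleton, hDy]
  have hT : ∀ j, (-a * dt α * (η * B (sc y)) + η * (B' * ds α y))
        * (-a * dt β * (η * B (sc y)) + η * (B' * ds β y))
        + (η * B (sc y)) ^ 2 * (η⁻¹ * dz α y j * (η⁻¹ * dz β y j))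
      = (-a * dt α * (η * B (sc y)) + η * (B' * ds α y))
        * (-a * dt β * (η * B (sc y)) + η * (B' * ds β y))
        + B (sc y) ^ 2 * (dz α y j * dz β y j) := by
    intro j
    field_simp
  have hL : ∀ j, (-a * dt α * (η * √κ * zc j y) + η * √κ * dz α y j)
        * (-a * dt β * (η * √κ * zc j y) + η * √κ * dz β y j)
      = η ^ 2 * κ * ((-a * dt α * zc j y + dz α y j) * (-a * dt β * zc j y + dz β y j)) := by
    intro j
    linear_combination η ^ 2 * ((-a * dt α * zc j y + dz α y j)
      * (-a * dt β * zc j y + dz β y j)) * hκ2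
  simp only [hT, hL, Fin.sum_univ_three, mul_zero, add_zero]
  rw [hg, hh, ← hm]
  generalize κ ^ 2 * (1 + η ^ 2) / (1 - κ * sc y) = K
  linear_combination -a * η ^ 2 * (dt α * ds β y + dt β * ds α y) * hm'
    - a ^ 2 * η ^ 2 * κ * dt α * dt β * hz + a * η ^ 2 * κ * dt α / 2 * hσβ
    + a * η ^ 2 * κ * dt β / 2 * hσα

end Construction

section Equations

variable {F : Type*} [NormedAddCommGroup F] [InnerProductSpace ℝ F] {u : Sp 3 → F}
  {Ω : Set (Sp 3)} {a κ m₀ : ℝ} {e g h : ℝ → ℝ}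

/-- The wave operator applied to the self-similar mass density `m₀ t ^ (-2a)`. -/
lemma dAlembert_mass (hΩ : IsOpen Ω) (hpos : ∀ y ∈ Ω, 0 < y 0)
    (hM : ∀ y ∈ Ω, ⟪u y, u y⟫ = y 0 ^ (-2 * a) * m₀) {y : Sp 3} (hy : y ∈ Ω) :
    dAlembert (fun z => ⟪u z, u z⟫) y = -(y 0 ^ (-2 * a - 2) * (2 * a * (2 * a + 1) * m₀)) := by
  have h1 : ∀ α : Fin 4, Set.EqOn (pd α fun z => ⟪u z, u z⟫)
      (fun z => z 0 ^ (-2 * a - 1) * (-2 * a * dt α * m₀)) Ω := by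
    intro α z hz
    have h0 := hasPd_rpow_mul (hpos z hz) (α := α) (-2 * a) (f' := 0)
      (by rw [zero_mul]; exact HasPd.const m₀)
    rw [(h0.congr_of_eqOn hΩ hz hM).pd_eq]
    ring
  have h2 : ∀ α : Fin 4, pd α (pd α fun z => ⟪u z, u z⟫) y
      = y 0 ^ (-2 * a - 2) * (2 * a * (2 * a + 1) * dt α ^ 2 * m₀) := by
    intro α
    have h0 := hasPd_rpow_mul (hpos y hy) (α := α) (-2 * a - 1) (f' := 0)
      (by rw [zero_mul]; exact HasPd.const (-2 * a * dt α * m₀))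
    rw [(h0.congr_of_eqOn hΩ hy (h1 α)).pd_eq]
    ring_nf
  simp only [dAlembert, h2, dt_zero, dt_succ]
  simp

variable (hΩ : IsOpen Ω) (hu : ContDiffOn ℝ ∞ u Ω) (hpos : ∀ y ∈ Ω, 0 < y 0)
  (hM : ∀ y ∈ Ω, ⟪u y, u y⟫ = y 0 ^ (-2 * a) * m₀)
  (hG : ∀ y ∈ Ω, ∀ α β, ⟪pd α u y, pd β u y⟫ = y 0 ^ (-2 * a - 2)
    * ((m₀ * a ^ 2 + 1 - κ * sc y) * (dt α * dt β) - κ / 2 * (dt α * ds β y + dt β * ds α y)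
      + g (sc y) * ∑ j, dz α y j * dz β y j + h (sc y) / 4 * (ds α y * ds β y)))
  (he : ∀ y ∈ Ω, e (sc y) = g (sc y) + sc y * h (sc y))

include hG he in
lemma gram_zero_zero {y : Sp 3} (hy : y ∈ Ω) :
    ⟪pd 0 u y, pd 0 u y⟫ = y 0 ^ (-2 * a - 2) * (m₀ * a ^ 2 + 1 + κ * sc y + sc y * e (sc y)) := by
  have hz : sc y = ∑ j, zc j y * zc j y := rfl
  simp only [hG y hy, dt_zero, ds_zero, dz_zero, neg_mul_neg, ← hz, he y hy]
  ring

include hG he in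
lemma gram_succ_zero {y : Sp 3} (hy : y ∈ Ω) (k : Fin 3) :
    ⟪pd k.succ u y, pd 0 u y⟫ = y 0 ^ (-2 * a - 2) * (-(κ + e (sc y)) * zc k y) := by
  rw [hG y hy, he y hy]
  congr 1
  simp only [dt_zero, dt_succ, ds_zero, ds_succ, dz_zero, dz_succ]
  simp only [ite_mul, one_mul, zero_mul, Finset.sum_ite_eq', Finset.mem_univ, if_true]
  ring

include hG in
lemma gram_succ_succ {y : Sp 3} (hy : y ∈ Ω) (k i : Fin 3) :
    ⟪pd k.succ u y, pd i.succ u y⟫ = y 0 ^ (-2 * a - 2)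
      * (g (sc y) * (if k = i then 1 else 0) + h (sc y) * (zc k y * zc i y)) := by
  rw [hG y hy]
  congr 1
  simp only [dt_succ, ds_succ, dz_succ]
  simp only [ite_mul, one_mul, zero_mul, Finset.sum_ite_eq', Finset.mem_univ, if_true, mul_zero]
  ring

include hG he in
lemma gram_trace {y : Sp 3} (hy : y ∈ Ω) :
    ∑ k : Fin 3, ⟪pd k.succ u y, pd k.succ u y⟫ = y 0 ^ (-2 * a - 2)
      * (2 * g (sc y) + e (sc y)) := by
  have hz : sc y = ∑ j, zc j y * zc j y := rfl
  simp only [gram_succ_succ hG hy, if_true, ← Finset.mul_sum, Finset.sum_add_distrib, ← hz,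
    he y hy]
  rw [Finset.sum_const, Finset.card_univ, Fintype.card_fin]
  ring

include hΩ hu hpos hM hG he in
lemma inner_dAlembert_eq {y : Sp 3} (hy : y ∈ Ω) :
    ⟪u y, dAlembert u y⟫ = y 0 ^ (-2 * a - 2)
      * (1 + κ * sc y - (1 - sc y) * e (sc y) - 2 * g (sc y) - a * (a + 1) * m₀) := by
  rw [inner_dAlembert hΩ hu hy, dAlembert_mass hΩ hpos hM hy, gram_zero_zero hG he hy,
    gram_trace hG he hy]
  ring

include hΩ hu hpos hM hG he in
/-- The profile equation implies `a ∂_α⟨u, □u⟩ = 2(1+a) ⟨∂_α u, □u⟩`. -/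
lemma pd_inner_dAlembert_eq (hκ : 3 * κ = 1 + 2 * a) {y : Sp 3} (hy : y ∈ Ω)
    {e' g' h' : ℝ}
    (hed : HasDerivAt e e' (sc y)) (hgd : HasDerivAt g g' (sc y)) (hhd : HasDerivAt h h' (sc y))
    (he' : e' = g' + h (sc y) + sc y * h')
    (hode : κ + e (sc y) - (1 - sc y) * e' - 2 * g'
      + 2 * (1 + a) * (-(a + 3 / 2) * (κ + e (sc y)) + (1 - sc y) * e' + h (sc y)) = 0)
    (α : Fin 4) :
    a * pd α (fun z => ⟪u z, dAlembert u z⟫) y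
      = 2 * (1 + a) * ⟪pd α u y, dAlembert u y⟫ := by
  have hy0 := hpos y hy
  have hz : sc y = ∑ j, zc j y * zc j y := rfl
  have hs := fun β => hasPd_sc hy0 β
  have hEV : HasPd α (fun z => ⟪u z, dAlembert u z⟫) _ y :=
    (hasPd_rpow_mul hy0 (-2 * a - 2) (hasPd_comp_sc hy0 α
      (F := fun s => 1 + κ * s - (1 - s) * e s - 2 * g s - a * (a + 1) * m₀)
      (F' := κ + e (sc y) - (1 - sc y) * e' - 2 * g')
      (by
        have := ((((hasDerivAt_id (sc y)).const_mul κ).const_add 1).sub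
          (((hasDerivAt_id (sc y)).const_sub 1).mul hed)).sub (hgd.const_mul 2) |>.sub_const
            (a * (a + 1) * m₀)
        refine this.congr_deriv ?_
        simp
        ring))).congr_of_eqOn hΩ hy fun z hz => inner_dAlembert_eq hΩ hu hpos hM hG he hz
  have h00 : ∀ β, HasPd β (fun z => ⟪pd 0 u z, pd 0 u z⟫) _ y := fun β =>
    (hasPd_rpow_mul hy0 (-2 * a - 2) (hasPd_comp_sc hy0 β
      (F := fun s => m₀ * a ^ 2 + 1 + κ * s + s * e s) (F' := κ + e (sc y) + sc y * e')
      (by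
        have := (((hasDerivAt_id (sc y)).const_mul κ).const_add (m₀ * a ^ 2 + 1)).add
          ((hasDerivAt_id (sc y)).mul hed)
        refine this.congr_deriv ?_
        simp
        ring))).congr_of_eqOn hΩ hy fun z hz => gram_zero_zero hG he hz
  have htr : ∀ β, HasPd β (fun z => ∑ k : Fin 3, ⟪pd k.succ u z, pd k.succ u z⟫) _ y := fun β =>
    (hasPd_rpow_mul hy0 (-2 * a - 2) (hasPd_comp_sc hy0 β
      (F := fun s => 2 * g s + e s) (F' := 2 * g' + e')
      ((hgd.const_mul 2).add hed))).congr_of_eqOn hΩ hy fun z hz => gram_trace hG he hz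
  have hk0 : ∀ β (k : Fin 3), HasPd β (fun z => ⟪pd k.succ u z, pd 0 u z⟫) _ y := fun β k =>
    (hasPd_rpow_mul hy0 (-2 * a - 2)
      (f' := -(e' * ds β y * zc k y) - (κ + e (sc y)) * dz β y k)
      (f := fun z => -(κ + e (sc z)) * zc k z) (by
        have := ((hasPd_comp_sc hy0 β (hed.const_add κ)).neg).mul (hasPd_zc hy0 β k)
        refine ⟨this.1, this.2.trans ?_⟩
        ring)).congr_of_eqOn hΩ hy fun z hz => gram_succ_zero hG he hz k
  have hki : ∀ β (k i : Fin 3), HasPd β (fun z => ⟪pd k.succ u z, pd i.succ u z⟫) _ y :=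
    fun β k i => (hasPd_rpow_mul hy0 (-2 * a - 2)
      (f' := g' * ds β y * (if k = i then 1 else 0) + h' * ds β y * (zc k y * zc i y)
        + h (sc y) * (dz β y k * zc i y + zc k y * dz β y i))
      (f := fun z => g (sc z) * (if k = i then 1 else 0) + h (sc z) * (zc k z * zc i z)) (by
        have := ((hasPd_comp_sc hy0 β hgd).mul (HasPd.const (if k = i then (1 : ℝ) else 0))).add
          ((hasPd_comp_sc hy0 β hhd).mul ((hasPd_zc hy0 β k).mul (hasPd_zc hy0 β i)))
        refine ⟨this.1, this.2.trans ?_⟩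
        ring)).congr_of_eqOn hΩ hy fun z hz => gram_succ_succ hG hz k i
  have hsum : ∑ i : Fin 3, pd α (fun z => ⟪pd i.succ u z, pd i.succ u z⟫) y
      = pd α (fun z => ∑ i : Fin 3, ⟪pd i.succ u z, pd i.succ u z⟫) y := by
    refine (HasPd.sum fun i _ => ?_).pd_eq.symm
    exact HasPd.of_differentiableAt (hki α i i).1
  rw [inner_pd_dAlembert hΩ hu α hy, hEV.pd_eq, hsum, (htr α).pd_eq, (h00 α).pd_eq]
  rw [Fin.sum_univ_three] at hz
  cases α using Fin.cases with
  | zero =>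
    simp only [real_inner_comm _ (pd 0 u _)]
    simp only [(hk0 _ _).pd_eq, (h00 0).pd_eq, dt_zero, dt_succ, ds_zero, ds_succ, dz_succ,
      Fin.sum_univ_three, if_true]
    generalize y 0 ^ (-2 * a - 2 - 1) = T
    linear_combination 2 * sc y * T * hode - 4 * (1 + a) * T * e' * hz
      + 4 * (1 + a) * T * he y hy + 2 * (1 + a) * T * hκ
  | succ k =>
    simp only [(hk0 _ _).pd_eq, (hki _ _ _).pd_eq, dt_zero, dt_succ, ds_zero, ds_succ, dz_zero,
      dz_succ]
    generalize y 0 ^ (-2 * a - 2 - 1) = T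
    have hk : ∑ i : Fin 3, T * ((-2 * a - 2) * 0 * ((g (sc y) * if k = i then 1 else 0)
          + h (sc y) * (zc k y * zc i y)) + ((g' * (2 * zc i y) * if k = i then 1 else 0)
          + h' * (2 * zc i y) * (zc k y * zc i y) + h (sc y) * ((if k = i then 1 else 0) * zc i y
          + zc k y * if True then 1 else 0)))
        = T * zc k y * (2 * g' + 2 * h' * sc y + 4 * h (sc y)) := by
      simp only [Fin.sum_univ_three, if_true]
      fin_cases k <;> simp
      · linear_combination -2 * T * h' * zc 0 y * hz
      · linear_combination -2 * T * h' * zc 1 y * hz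
      · linear_combination -2 * T * h' * zc 2 y * hz
    rw [hk]
    linear_combination -2 * zc k y * T * hode + 4 * (1 + a) * T * zc k y * he'

end Equations

section DirectionMap

variable {ι F : Type*} [Fintype ι] [NormedAddCommGroup F] [InnerProductSpace ℝ F]
  {v : ι ⊕ ι → F} {d : ℕ}

lemma inner_radial_pd_polarSum (hv : Orthonormal ℝ v) {A φ : ι → Sp d → ℝ} {A' φ' : ι → ℝ}
    {α : Fin (d + 1)} {y : Sp d}
    (hA : ∀ n, HasPd α (A n) (A' n) y) (hφ : ∀ n, HasPd α (φ n) (φ' n) y) (n : ι) :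
    ⟪cos (φ n y) • v (.inl n) + sin (φ n y) • v (.inr n), pd α (polarSum v A φ) y⟫ = A' n := by
  classical
  rw [(hasPd_polarSum hA hφ).pd_eq]
  simp [inner_sum, inner_add_right, inner_smul_right, inner_add_left, inner_smul_left,
    orthonormal_iff_ite.1 hv, Finset.sum_add_distrib]
  linear_combination A' n * sin_sq_add_cos_sq (φ n y)

lemma inner_tangential_pd_polarSum (hv : Orthonormal ℝ v) {A φ : ι → Sp d → ℝ} {A' φ' : ι → ℝ}
    {α : Fin (d + 1)} {y : Sp d}
    (hA : ∀ n, HasPd α (A n) (A' n) y) (hφ : ∀ n, HasPd α (φ n) (φ' n) y) (n : ι) :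
    ⟪-sin (φ n y) • v (.inl n) + cos (φ n y) • v (.inr n), pd α (polarSum v A φ) y⟫
      = A n y * φ' n := by
  classical
  rw [(hasPd_polarSum hA hφ).pd_eq]
  simp [inner_sum, inner_add_right, inner_smul_right, inner_add_left, inner_smul_left,
    orthonormal_iff_ite.1 hv, Finset.sum_add_distrib]
  linear_combination A n y * φ' n * sin_sq_add_cos_sq (φ n y)

end DirectionMap

section SelfSimilarMap

variable {F : Type*} [NormedAddCommGroup F] [InnerProductSpace ℝ F]
  {v : PlaneIndex ⊕ PlaneIndex → F} {a η κ l r m₀ : ℝ} {B C ψ : ℝ → ℝ} {y y' : Sp 3}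

/-- The open conical region of points whose self-similar radius squared lies in `(l, r)`. -/
def region (l r : ℝ) : Set (Sp 3) := {y | 0 < y 0 ∧ sc y ∈ Set.Ioo l r}

lemma contDiffOn_zc (l r : ℝ) (j : Fin 3) : ContDiffOn ℝ ∞ (zc j) (region l r) :=
  (contDiff_apply ℝ ℝ j.succ).contDiffOn.mul
    ((contDiff_apply ℝ ℝ (0 : Fin 4)).contDiffOn.inv fun _ hy => hy.1.ne')

lemma contDiffOn_sc (l r : ℝ) : ContDiffOn ℝ ∞ sc (region l r) :=
  ContDiffOn.sum fun j _ => (contDiffOn_zc l r j).mul (contDiffOn_zc l r j)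

lemma isOpen_region (l r : ℝ) : IsOpen (region l r) := by
  have hopen : IsOpen {y : Sp 3 | 0 < y 0} := isOpen_lt continuous_const (continuous_apply 0)
  have hc : ContinuousOn sc {y : Sp 3 | 0 < y 0} := by
    refine continuousOn_finsetSum _ fun j _ => ?_
    have hz : ContinuousOn (zc j) {y : Sp 3 | 0 < y 0} :=
      (continuous_apply _).continuousOn.mul
        ((continuous_apply _).continuousOn.inv₀ fun y hy => ne_of_gt hy)
    exact hz.mul hz
  exact hc.isOpen_inter_preimage hopen isOpen_Ioo

lemma cone_subset_region (hl : l < 0) (hr : 1 < r) : Cone 3 ⊆ region l r := fun y hy =>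
  ⟨hy.1, hl.trans_le (sc_nonneg y), (sc_le_one hy).trans_lt hr⟩

lemma contDiffOn_ssMap (hs : ∀ s ∈ Set.Ioo l r, 0 < 1 - κ * s)
    (hB : ContDiffOn ℝ ∞ B (Set.Ioo l r)) (hC : ContDiffOn ℝ ∞ C (Set.Ioo l r))
    (hψ : ContDiffOn ℝ ∞ ψ (Set.Ioo l r)) :
    ContDiffOn ℝ ∞ (ssMap v a η κ B C ψ) (region l r) := by
  have ht : ContDiffOn ℝ ∞ (fun y : Sp 3 => y 0) (region l r) :=
    (contDiff_apply ℝ ℝ (0 : Fin 4)).contDiffOn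
  have hsc := contDiffOn_sc l r
  have hmaps : Set.MapsTo sc (region l r) (Set.Ioo l r) := fun y hy => hy.2
  have hlin : ContDiffOn ℝ ∞ (fun y => 1 - κ * sc y) (region l r) :=
    contDiffOn_const.sub (contDiffOn_const.mul hsc)
  have hne : ∀ y ∈ region l r, 1 - κ * sc y ≠ 0 := fun y hy => (hs _ hy.2).ne'
  refine contDiffOn_polarSum (fun n => ?_) fun n => ?_
  · refine (ht.rpow_const_of_ne fun y hy => hy.1.ne').mul ?_
    rcases n with _ | _ | _ | j
    · exact contDiffOn_const.mul (hlin.sqrt hne)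
    · exact contDiffOn_const.mul (hC.comp hsc hmaps)
    · exact contDiffOn_const.mul (hB.comp hsc hmaps)
    · exact contDiffOn_const.mul (contDiffOn_zc l r j)
  · rcases n with _ | _ | j | _
    · exact contDiffOn_const.mul ((ht.log fun y hy => hy.1.ne').add ((hlin.log hne).div_const 2))
    · exact hψ.comp hsc hmaps
    · exact contDiffOn_const.mul (contDiffOn_zc l r j)
    · exact contDiffOn_const

lemma zc_smul {c : ℝ} (hc : 0 < c) (j : Fin 3) (y : Sp 3) : zc j (c • y) = zc j y := by
  simp only [zc, Pi.smul_apply, smul_eq_mul, mul_inv]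
  field_simp

lemma sc_smul {c : ℝ} (hc : 0 < c) (y : Sp 3) : sc (c • y) = sc y := by
  simp only [sc, zc_smul hc]

lemma ssMap_smul (hη : 0 < η) (hy : 0 < y 0) :
    ssMap v a η κ B C ψ (exp (2 * π * η) • y)
      = exp (-a * (2 * π * η)) • ssMap v a η κ B C ψ y := by
  have hamp : ∀ n, amp η κ B C n (exp (2 * π * η) • y) = amp η κ B C n y := by
    rintro (_ | _ | _ | j) <;> simp [amp, sc_smul (exp_pos _), zc_smul (exp_pos _)]
  have hpow : (exp (2 * π * η) • y) 0 ^ (-a) = exp (-a * (2 * π * η)) * y 0 ^ (-a) := by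
    rw [Pi.smul_apply, smul_eq_mul, mul_rpow (exp_pos _).le hy.le, ← exp_mul, mul_comm (-a)]
  have hphase : ∀ n, cos (phase η κ ψ n (exp (2 * π * η) • y)) = cos (phase η κ ψ n y) ∧
      sin (phase η κ ψ n (exp (2 * π * η) • y)) = sin (phase η κ ψ n y) := by
    rintro (_ | _ | _ | _)
    · have h : phase η κ ψ (.inl ()) (exp (2 * π * η) • y)
          = phase η κ ψ (.inl ()) y + 2 * π := by
        simp only [phase, Sum.elim_inl, sc_smul (exp_pos _), Pi.smul_apply, smul_eq_mul]
        rw [log_mul (exp_pos _).ne' hy.ne', log_exp]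
        field_simp
        ring
      rw [h, cos_add_two_pi, sin_add_two_pi]
      exact ⟨rfl, rfl⟩
    all_goals simp [phase, sc_smul (exp_pos _), zc_smul (exp_pos _)]
  simp only [ssMap, polarSum, Finset.smul_sum, smul_add, smul_smul, hamp, hpow, (hphase _).1,
    (hphase _).2]
  simp only [mul_assoc]

lemma ssMap_direction (hv : Orthonormal ℝ v) (hy : 0 < y 0) (hκ : 0 ≤ κ)
    (hs : 0 < 1 - κ * sc y)
    (hm : η ^ 2 + 3 * η ^ 2 * B (sc y) ^ 2 + η ^ 2 * C (sc y) ^ 2 = m₀) :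
    ‖ssMap v a η κ B C ψ y‖⁻¹ • ssMap v a η κ B C ψ y
      = polarSum v (fun n y => (√m₀)⁻¹ * amp η κ B C n y) (phase η κ ψ) y := by
  have hnorm : ‖ssMap v a η κ B C ψ y‖ = y 0 ^ (-a) * √m₀ := by
    rw [norm_eq_sqrt_real_inner, inner_ssMap hv hy hκ hs, hm, sqrt_mul (by positivity)]
    congr 1
    rw [show -2 * a = -a * (2 : ℕ) by push_cast; ring, rpow_mul_natCast hy.le,
      sqrt_sq (by positivity)]
  rw [hnorm, ssMap, polarSum, polarSum, Finset.smul_sum]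
  refine Finset.sum_congr rfl fun n _ => ?_
  have hp : y 0 ^ (-a) ≠ 0 := (rpow_pos_of_pos hy _).ne'
  rw [smul_add, smul_smul, smul_smul, mul_inv]
  congr 2 <;> field_simp

lemma eq_smul_of_polarSum_eq (hv : Orthonormal ℝ v) (hη : 0 < η) (hκ : 0 < κ) {c : ℝ}
    (hc : 0 < c) (hy : 0 < y 0) (hy' : 0 < y' 0) (hs : 0 < 1 - κ * sc y)
    (h : polarSum v (fun n y => c * amp η κ B C n y) (phase η κ ψ) y
      = polarSum v (fun n y => c * amp η κ B C n y) (phase η κ ψ) y') :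
    ∃ n : ℤ, y' = exp (n * (2 * π * η)) • y := by
  have hcos := fun n => congrArg (fun w => ⟪v (.inl n), w⟫) h
  have hsin := fun n => congrArg (fun w => ⟪v (.inr n), w⟫) h
  simp only [inner_polarSum_inl hv, inner_polarSum_inr hv] at hcos hsin
  have hz : ∀ j, zc j y = zc j y' := by
    intro j
    have h1 := hcos (.inr (.inr (.inr j)))
    simpa [amp, phase, hc.ne', hη.ne', (sqrt_pos.2 hκ).ne'] using h1
  have hsc : sc y = sc y' := by simp only [sc, hz]
  have hP : √(1 - κ * sc y') ≠ 0 := by rw [← hsc]; exact (sqrt_pos.2 hs).ne'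
  have hc0 := hcos (.inl ())
  have hs0 := hsin (.inl ())
  simp only [amp, phase, Sum.elim_inl, hsc, mul_eq_mul_left_iff, mul_eq_zero, hc.ne', hη.ne', hP,
    or_false] at hc0 hs0
  obtain ⟨n, hn⟩ := Real.Angle.angle_eq_iff_two_pi_dvd_sub.1 (Real.Angle.cos_sin_inj hc0 hs0)
  have hlog : log (y' 0) = -n * (2 * π * η) + log (y 0) := by
    field_simp at hn
    linarith
  have h0 : y' 0 = exp ((-n : ℤ) * (2 * π * η)) * y 0 := by
    rw [← exp_log hy', hlog, exp_add, exp_log hy]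
    push_cast
    rfl
  refine ⟨-n, funext fun i => ?_⟩
  cases i using Fin.cases with
  | zero => exact h0
  | succ j =>
    have hj := hz j
    simp only [zc] at hj
    rw [Pi.smul_apply, smul_eq_mul]
    rw [← div_eq_mul_inv, ← div_eq_mul_inv, div_eq_div_iff hy.ne' hy'.ne', h0] at hj
    have := mul_right_cancel₀ hy.ne' (b := y 0) (a := y' j.succ)
      (c := exp ((-n : ℤ) * (2 * π * η)) * y j.succ) (by linarith)
    exact this

lemma linearIndependent_pd_polarSum (hv : Orthonormal ℝ v) (hη : 0 < η) (hκ : 0 < κ) {c : ℝ}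
    (hc : 0 < c) (hy : 0 < y 0) (hs : 0 < 1 - κ * sc y) {B' C' ψ' : ℝ}
    (hB : HasDerivAt B B' (sc y)) (hC : HasDerivAt C C' (sc y)) (hψ : HasDerivAt ψ ψ' (sc y)) :
    LinearIndependent ℝ fun α : Fin 4 =>
      pd α (polarSum v (fun n y => c * amp η κ B C n y) (phase η κ ψ)) y := by
  rw [Fintype.linearIndependent_iff]
  intro k hk
  have hA := fun α n => (hasPd_amp (η := η) hy hs hB hC α n).const_mul c
  have hφ := fun α n => hasPd_phase (η := η) hy hs hψ α n
  have hz : ∀ j, ∑ α, k α * dz α y j = 0 := by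
    intro j
    have h1 := congrArg (fun w => ⟪cos (phase η κ ψ (.inr (.inr (.inr j))) y)
      • v (.inl (.inr (.inr (.inr j)))) + sin (phase η κ ψ (.inr (.inr (.inr j))) y)
      • v (.inr (.inr (.inr (.inr j)))), w⟫) hk
    simp only [inner_sum, inner_smul_right, inner_radial_pd_polarSum hv (hA _) (hφ _),
      inner_zero_right] at h1
    have h2 : c * (η * √κ) * (y 0)⁻¹ * ∑ α, k α * dz α y j = 0 := by
      rw [← h1, Finset.mul_sum]
      refine Finset.sum_congr rfl fun α _ => ?_
      simp only [damp, Sum.elim_inr]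
      ring
    exact (mul_eq_zero.1 h2).resolve_left
      (mul_pos (mul_pos hc (mul_pos hη (sqrt_pos.2 hκ))) (inv_pos.2 hy)).ne'
  have hds : ∑ α, k α * ds α y = 0 := by
    have h1 : ∑ α, k α * ds α y = 2 * ∑ j, zc j y * ∑ α, k α * dz α y j := by
      simp only [ds, Finset.mul_sum]
      rw [Finset.sum_comm]
      exact Finset.sum_congr rfl fun j _ => Finset.sum_congr rfl fun α _ => by ring
    rw [h1]
    simp [hz]
  have hdt : ∑ α, k α * dt α = 0 := by
    have h1 := congrArg (fun w => ⟪-sin (phase η κ ψ (.inl ()) y)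
      • v (.inl (.inl ())) + cos (phase η κ ψ (.inl ()) y) • v (.inr (.inl ())), w⟫) hk
    simp only [inner_sum, inner_smul_right, inner_tangential_pd_polarSum hv (hA _) (hφ _),
      inner_zero_right] at h1
    have h2 : c * √(1 - κ * sc y) * (y 0)⁻¹ * (∑ α, k α * dt α
        - κ / (2 * (1 - κ * sc y)) * ∑ α, k α * ds α y) = 0 := by
      rw [← h1, mul_sub, Finset.mul_sum, Finset.mul_sum, Finset.mul_sum,
        ← Finset.sum_sub_distrib]
      refine Finset.sum_congr rfl fun α _ => ?_
      simp only [amp, dphase, Sum.elim_inl]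
      field_simp
    rw [hds, mul_zero, sub_zero] at h2
    exact (mul_eq_zero.1 h2).resolve_left
      (mul_pos (mul_pos hc (sqrt_pos.2 hs)) (inv_pos.2 hy)).ne'
  have h0 : k 0 = 0 := by simpa [dt] using hdt
  intro α
  cases α using Fin.cases with
  | zero => exact h0
  | succ j => simpa [Fin.sum_univ_succ, dz_zero, dz_succ, h0] using hz j

end SelfSimilarMap

/-- Theorem 3.1, second reduction.  For `d = 3`, `p > 5`, `m ≥ 40` there
exist `S > 0` and a smooth nowhere-vanishing discretely self-similar `u : Γ₃ → ℝ^m \ {0}`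
with `⟨u, □u⟩ > 0`, `∂_α⟨u,□u⟩ = (p+1)⟨∂_α u, □u⟩`, whose direction map
`θ = u/‖u‖ : Γ₃ → S^{m-1}` is injective up to the discrete scaling and immersed. -/
theorem stmt4 (p : ℝ) (hp : 5 < p) (m : ℕ) (hm : 40 ≤ m) :
    ∃ S : ℝ, 0 < S ∧
    ∃ (u : Sp 3 → Em m) (Ω : Set (Sp 3)),
      IsOpen Ω ∧ Cone 3 ⊆ Ω ∧ ContDiffOn ℝ (⊤ : ℕ∞) u Ω ∧
      (∀ y ∈ Cone 3, u y ≠ 0) ∧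
      -- discrete self-similarity
      (∀ y ∈ Cone 3, u (Real.exp S • y) = Real.exp (-(2 / (p - 1)) * S) • u y) ∧
      -- the defocusing property `⟨u, □u⟩ > 0`
      (∀ y ∈ Cone 3, 0 < ⟪u y, dAlembert u y⟫) ∧
      -- the equations `∂_α ⟨u, □u⟩ = (p+1) ⟨∂_α u, □u⟩`
      (∀ α : Fin 4, ∀ y ∈ Cone 3,
        pd α (fun z => ⟪u z, dAlembert u z⟫) y = (p + 1) * ⟪pd α u y, dAlembert u y⟫) ∧
      -- `θ = u/‖u‖` is injective up to the discrete scaling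
      (∀ y ∈ Cone 3, ∀ y' ∈ Cone 3,
        ‖u y‖⁻¹ • u y = ‖u y'‖⁻¹ • u y' → ∃ n : ℤ, y' = Real.exp ((n : ℝ) * S) • y) ∧
      -- `θ` is immersed: the four derivatives `∂_α θ` are linearly independent
      (∀ y ∈ Cone 3,
        LinearIndependent ℝ (fun α : Fin 4 => pd α (fun z => ‖u z‖⁻¹ • u z) y)) := by
  set a := 2 / (p - 1) with ha_def
  have hp1 : 0 < p - 1 := by linarith
  have ha : 0 < a := by positivity
  have ha2 : a < 1 / 2 := by
    rw [ha_def, div_lt_iff₀ hp1]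
    linarith
  have hap : a * (p - 1) = 2 := div_mul_cancel₀ _ hp1.ne'
  have hκ3 : 3 * ((1 + 2 * a) / 3) = 1 + 2 * a := by ring
  generalize (1 + 2 * a) / 3 = κ at hκ3
  have hκ : 0 < κ := by linarith
  obtain ⟨e, g, h, B, C, ψ, l, r, ε, m₀, hl, hr, hε, hes, hgs, hhs, hBs, hCs, hψs, he, hode, hs,
    hm₀, hg, hh, hpos⟩ := exists_components ha ha2 hκ3
  obtain ⟨η, hη, rfl⟩ : ∃ η, 0 < η ∧ η ^ 2 = ε := ⟨√ε, sqrt_pos.2 hε, sq_sqrt hε.le⟩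
  have hm₀pos : 0 < m₀ := by
    rw [← hm₀ 0 ⟨hl, by linarith⟩]
    positivity
  have hderiv : ∀ {f : ℝ → ℝ}, ContDiffOn ℝ ∞ f (Set.Ioo l r) → ∀ s ∈ Set.Ioo l r,
      HasDerivAt f (deriv f s) s := fun hf s hsI =>
    ((hf.differentiableOn (by simp)).differentiableAt (isOpen_Ioo.mem_nhds hsI)).hasDerivAt
  have hm' : ∀ s ∈ Set.Ioo l r, 3 * (B s * deriv B s) + C s * deriv C s = 0 := by
    intro s hsI
    have h1 : HasDerivAt (fun s => η ^ 2 + 3 * η ^ 2 * B s ^ 2 + η ^ 2 * C s ^ 2) _ s :=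
      ((((hderiv hBs s hsI).pow 2).const_mul (3 * η ^ 2)).const_add (η ^ 2)).add
        (((hderiv hCs s hsI).pow 2).const_mul (η ^ 2))
    have h2 := ((hasDerivAt_const s m₀).congr_of_eventuallyEq
      (Filter.eventuallyEq_of_mem (isOpen_Ioo.mem_nhds hsI) hm₀)).unique h1
    have h3 : 2 * η ^ 2 * (3 * (B s * deriv B s) + C s * deriv C s) = 0 := by
      rw [h2]
      push_cast
      ring
    exact (mul_eq_zero.1 h3).resolve_left (by positivity)
  have he' : ∀ s ∈ Set.Ioo l r, deriv e s = deriv g s + h s + s * deriv h s := by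
    intro s hsI
    have h1 := ((hderiv hgs s hsI).add ((hasDerivAt_id s).mul (hderiv hhs s hsI)))
    rw [(h1.congr_of_eventuallyEq
      (Filter.eventuallyEq_of_mem (isOpen_Ioo.mem_nhds hsI) he)).deriv]
    simp
    ring
  obtain ⟨f⟩ : Nonempty (PlaneIndex ⊕ PlaneIndex ↪ Fin m) :=
    Function.Embedding.nonempty_of_card_le (by simp; omega)
  have hv : Orthonormal ℝ fun n => EuclideanSpace.basisFun (Fin m) ℝ (f n) :=
    (EuclideanSpace.basisFun (Fin m) ℝ).orthonormal.comp f f.injective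
  generalize (fun n => EuclideanSpace.basisFun (Fin m) ℝ (f n)) = v at hv
  have hΩ := isOpen_region l r
  have hcone := cone_subset_region hl hr
  have hu : ContDiffOn ℝ ∞ (ssMap v a η κ B C ψ) (region l r) := contDiffOn_ssMap hs hBs hCs hψs
  have hM : ∀ y ∈ region l r, ⟪ssMap v a η κ B C ψ y, ssMap v a η κ B C ψ y⟫
      = y 0 ^ (-2 * a) * m₀ := fun y hy => by
    rw [inner_ssMap hv hy.1 hκ.le (hs _ hy.2), hm₀ _ hy.2]
  have hG := fun y (hy : y ∈ region l r) => inner_pd_ssMap (a := a) hv hy.1 hη hκ.le (hs _ hy.2)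
    (hderiv hBs _ hy.2) (hderiv hCs _ hy.2) (hderiv hψs _ hy.2) (hm₀ _ hy.2) (hm' _ hy.2)
    (hg _ hy.2) (hh _ hy.2)
  have hθ : Set.EqOn (fun z => ‖ssMap v a η κ B C ψ z‖⁻¹ • ssMap v a η κ B C ψ z)
      (polarSum v (fun n y => (√m₀)⁻¹ * amp η κ B C n y) (phase η κ ψ)) (region l r) :=
    fun y hy => ssMap_direction hv hy.1 hκ.le (hs _ hy.2) (hm₀ _ hy.2)
  have hc : 0 < (√m₀)⁻¹ := inv_pos.2 (sqrt_pos.2 hm₀pos)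
  refine ⟨2 * π * η, by positivity, ssMap v a η κ B C ψ, region l r, hΩ, hcone, hu, ?_, ?_, ?_, ?_,
    ?_, ?_⟩
  · intro y hy h0
    have h1 := hM y (hcone hy)
    rw [h0, inner_zero_left] at h1
    exact (mul_pos (rpow_pos_of_pos hy.1 _) hm₀pos).ne h1
  · exact fun y hy => ssMap_smul hη hy.1
  · intro y hy
    rw [inner_dAlembert_eq hΩ hu (fun y hy => hy.1) hM hG (fun y hy => he _ hy.2) (hcone hy)]
    exact mul_pos (rpow_pos_of_pos hy.1 _)
      (by linarith [hpos _ (sc_nonneg y) (sc_le_one hy)])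
  · intro α y hy
    have hI := (hcone hy).2
    have h1 := pd_inner_dAlembert_eq hΩ hu (fun y hy => hy.1) hM hG (fun y hy => he _ hy.2) hκ3
      (hcone hy) (hderiv hes _ hI) (hderiv hgs _ hI) (hderiv hhs _ hI) (he' _ hI) (hode _ hI) α
    refine mul_left_cancel₀ ha.ne' (h1.trans ?_)
    rw [← mul_assoc]
    congr 1
    linarith
  · intro y hy y' hy' h1
    have h2 := ((hθ (hcone hy)).symm.trans h1).trans (hθ (hcone hy'))
    exact eq_smul_of_polarSum_eq hv hη hκ hc hy.1 hy'.1 (hs _ (hcone hy).2) h2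
  · intro y hy
    have hI := (hcone hy).2
    have h1 : ∀ α, pd α (fun z => ‖ssMap v a η κ B C ψ z‖⁻¹ • ssMap v a η κ B C ψ z) y
        = pd α (polarSum v (fun n y => (√m₀)⁻¹ * amp η κ B C n y) (phase η κ ψ)) y := by
      intro α
      rw [pd, (hθ.eventuallyEq_of_mem (hΩ.mem_nhds (hcone hy))).fderiv_eq, pd]
    simp only [h1]
    exact linearIndependent_pd_polarSum hv hη hκ hc hy.1 (hs _ hI) (hderiv hBs _ hI)
      (hderiv hCs _ hI) (hderiv hψs _ hI)
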